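/- arXiv:2003.08501 — 2 statements merged into one kernel-verified Lean document; each statement's English description precedes it below -/
import Mathlib

section
/- Theorem 1.1(g). Fix an integer i ≥ 2 and suppose k = k(n) = n^{1 + 1/i + o(1)}, i.e. ln k(n) / ln n → 1 + 1/i as n → ∞. (1) If there exists ε > 0 such that (k/n)^i < (1−ε)·n ln n for all sufficiently large n, then asymptotically almost surely ξ(K_n, k) = i + 1. (2) If there exists ε > 0 such that (k/n)^i > (1+ε)·n ln n for all sufficiently large n, then asymptotically almost surely ξ(K_n, k) = i. (3) In all cases, asymptotically almost surely ξ(K_n, k) ∈ {i, i+1}. -/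
open Finset Filter

/-- Positions: `p t a` is the vertex (an element of `Fin n`) occupied by agent `a` at the end of
round `t`. `greenSet n k p t` is the set of green agents at the end of round `t`; the initially
green agent is the agent with index `0`, and a white agent becomes green as soon as it occupies
the same vertex as a green agent. -/
def greenSet (n k : ℕ) (p : ℕ → Fin k → Fin n) : ℕ → Finset (Fin k)
  | 0 => Finset.univ.filter fun a => ∃ b : Fin k, (b : ℕ) = 0 ∧ p 0 a = p 0 b
  | t + 1 =>
      greenSet n k p t ∪
        Finset.univ.filter fun a => ∃ b ∈ greenSet n k p t, p (t + 1) a = p (t + 1) b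

/-- The probability that the `k` agents follow the trajectory prefix `p` during rounds
`0, 1, …, T`: each agent starts at a uniformly random vertex of `K_n` and then moves, each round
and independently of everything else, to a uniformly random vertex distinct from its current
one. -/
noncomputable def prefixProb (n k T : ℕ) (p : Fin (T + 1) → Fin k → Fin n) : ℝ :=
  ∏ a : Fin k, ((n : ℝ)⁻¹ *
    ∏ t : Fin T, if p t.succ a = p t.castSucc a then 0 else ((n : ℝ) - 1)⁻¹)

/-- `probXiLe n k T` is `P(ξ(K_n, k) ≤ T)`: the probability that the broadcast is complete by
the end of round `T`. -/
noncomputable def probXiLe (n k T : ℕ) : ℝ :=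
  ∑ p : Fin (T + 1) → Fin k → Fin n,
    if greenSet n k (fun t a => p ⟨min t T, Nat.lt_succ_of_le (min_le_right t T)⟩ a) T
        = Finset.univ
      then prefixProb n k T p else 0

/-- `probXiEq n k t` is `P(ξ(K_n, k) = t)`. -/
noncomputable def probXiEq (n k : ℕ) : ℕ → ℝ
  | 0 => probXiLe n k 0
  | t + 1 => probXiLe n k (t + 1) - probXiLe n k t

/-- `probXiMem n k S` is `P(ξ(K_n, k) ∈ S)`: the probability that the broadcasting time of the
process with `k` agents on `K_n` belongs to the set `S ⊆ ℕ`. -/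
noncomputable def probXiMem (n k : ℕ) (S : Set ℕ) : ℝ :=
  ∑' t, S.indicator (probXiEq n k) t

/-- `expXi n k = E[ξ(K_n, k)] = ∑_{t ≥ 0} P(ξ(K_n, k) > t)`. -/
noncomputable def expXi (n k : ℕ) : ℝ :=
  ∑' t, (1 - probXiLe n k t)

namespace Broadcasting

section ProductWeights

variable {α β : Type*} [Fintype α] [DecidableEq α] [Fintype β]

/-- The real-valued indicator of a proposition. -/
noncomputable def ind (p : Prop) : ℝ := open Classical in if p then 1 else 0

lemma ind_of {p : Prop} (h : p) : ind p = 1 := if_pos h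

lemma ind_of_not {p : Prop} (h : ¬p) : ind p = 0 := if_neg h

lemma ind_nonneg (p : Prop) : 0 ≤ ind p := by
  unfold ind; split_ifs <;> norm_num

lemma ind_le_one (p : Prop) : ind p ≤ 1 := by
  unfold ind; split_ifs <;> norm_num

lemma ind_not (p : Prop) : ind (¬p) = 1 - ind p := by
  by_cases h : p <;> simp [ind, h]

lemma ind_mono {p q : Prop} (h : p → q) : ind p ≤ ind q := by
  by_cases hp : p
  · rw [ind_of hp, ind_of (h hp)]
  · rw [ind_of_not hp]; exact ind_nonneg q

lemma ind_or_le (p q : Prop) : ind (p ∨ q) ≤ ind p + ind q := by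
  by_cases hp : p <;> by_cases hq : q <;> simp [ind, hp, hq]

/-- The expectation of `F y` when the coordinates `y a` are independent with weights `f a`. -/
noncomputable def prodExp (f : α → β → ℝ) (F : (α → β) → ℝ) : ℝ :=
  ∑ y, (∏ a, f a (y a)) * F y

/-- The probability of an event under independent coordinates with weights `f a`. -/
noncomputable def prodProb (f : α → β → ℝ) (s : (α → β) → Prop) : ℝ :=
  prodExp f fun y => ind (s y)

/-- Every `f a` is a probability vector. -/
structure IsKernel (f : α → β → ℝ) : Prop where
  nonneg : ∀ a v, 0 ≤ f a v
  sum_eq_one : ∀ a, ∑ v, f a v = 1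

lemma prodExp_prod (f h : α → β → ℝ) :
    prodExp f (fun y => ∏ a, h a (y a)) = ∏ a, ∑ v, f a v * h a v := by
  simp only [prodExp, ← Finset.prod_mul_distrib]
  rw [Finset.prod_univ_sum, Fintype.piFinset_univ]

lemma prodExp_add (f : α → β → ℝ) (F H : (α → β) → ℝ) :
    prodExp f (fun y => F y + H y) = prodExp f F + prodExp f H := by
  simp [prodExp, mul_add, Finset.sum_add_distrib]

lemma prodExp_sub (f : α → β → ℝ) (F H : (α → β) → ℝ) :
    prodExp f (fun y => F y - H y) = prodExp f F - prodExp f H := by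
  simp [prodExp, mul_sub, Finset.sum_sub_distrib]

lemma prodExp_sum {ι : Type*} (f : α → β → ℝ) (s : Finset ι) (F : ι → (α → β) → ℝ) :
    prodExp f (fun y => ∑ j ∈ s, F j y) = ∑ j ∈ s, prodExp f (F j) := by
  simp only [prodExp, Finset.mul_sum]
  exact Finset.sum_comm

lemma prodExp_const_mul (f : α → β → ℝ) (c : ℝ) (F : (α → β) → ℝ) :
    prodExp f (fun y => c * F y) = c * prodExp f F := by
  simp only [prodExp, Finset.mul_sum]
  exact Finset.sum_congr rfl fun _ _ => by ring

/-- Resampling: taking the coordinates in `A` and those outside `A` from two independent copies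
does not change the law. -/
lemma prodExp_merge {f : α → β → ℝ} (hf : IsKernel f) (A : Finset α) (F : (α → β) → ℝ) :
    prodExp f F =
      prodExp f fun z => prodExp f fun y => F fun a => if a ∈ A then z a else y a := by
  have key (w : α → β) :
      prodExp f (fun z => prodExp f fun y => ind ((fun a => if a ∈ A then z a else y a) = w))
        = ∏ a, f a (w a) := by
    have e (z y : α → β) : ind ((fun a => if a ∈ A then z a else y a) = w)
        = ∏ a, if a ∈ A then ind (z a = w a) else ind (y a = w a) := by
      by_cases h : (fun a => if a ∈ A then z a else y a) = w
      · rw [ind_of h, Finset.prod_eq_one]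
        intro a _
        have := congrFun h a
        split_ifs with ha
        · exact ind_of (by simpa [ha] using this)
        · exact ind_of (by simpa [ha] using this)
      · rw [ind_of_not h]
        obtain ⟨a, ha⟩ := Function.ne_iff.mp h
        refine (Finset.prod_eq_zero (Finset.mem_univ a) ?_).symm
        split_ifs with hA
        · exact ind_of_not (by simpa [hA] using ha)
        · exact ind_of_not (by simpa [hA] using ha)
    simp only [e]
    have hs (a : α) : ∑ v, f a v * ind (v = w a) = f a (w a) := by
      rw [Finset.sum_eq_single (w a)]
      · rw [ind_of rfl, mul_one]
      · intro v _ hv; rw [ind_of_not hv, mul_zero]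
      · simp
    have e1 (z : α → β) :
        prodExp f (fun y => ∏ a, if a ∈ A then ind (z a = w a) else ind (y a = w a))
          = ∏ a, if a ∈ A then ind (z a = w a) else f a (w a) := by
      rw [prodExp_prod f (fun a v => if a ∈ A then ind (z a = w a) else ind (v = w a))]
      refine Finset.prod_congr rfl fun a _ => ?_
      split_ifs
      · rw [← Finset.sum_mul, hf.sum_eq_one, one_mul]
      · exact hs a
    simp only [e1]
    rw [prodExp_prod f (fun a v => if a ∈ A then ind (v = w a) else f a (w a))]
    refine Finset.prod_congr rfl fun a _ => ?_
    split_ifs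
    · exact hs a
    · rw [← Finset.sum_mul, hf.sum_eq_one, one_mul]
  have hF (y : α → β) : F y = ∑ w, F w * ind (y = w) := by
    rw [Finset.sum_eq_single y]
    · rw [ind_of rfl, mul_one]
    · intro v _ hv; rw [ind_of_not hv.symm, mul_zero]
    · simp
  have e2 (z : α → β) :
      prodExp f (fun y => F fun a => if a ∈ A then z a else y a) =
      ∑ w, F w * prodExp f (fun y => ind ((fun a => if a ∈ A then z a else y a) = w)) := by
    simp only [← prodExp_const_mul, ← prodExp_sum]
    congr 1
    funext y
    exact hF _
  simp only [e2, prodExp_sum, prodExp_const_mul, key]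
  exact Finset.sum_congr rfl fun _ _ => mul_comm _ _

namespace IsKernel

variable {f : α → β → ℝ} (hf : IsKernel f)

include hf

lemma prodExp_mono {F H : (α → β) → ℝ} (h : ∀ y, F y ≤ H y) : prodExp f F ≤ prodExp f H :=
  Finset.sum_le_sum fun y _ =>
    mul_le_mul_of_nonneg_left (h y) (Finset.prod_nonneg fun a _ => hf.nonneg a _)

lemma prodExp_const (c : ℝ) : prodExp f (fun _ => c) = c := by
  have h := prodExp_prod f (fun _ _ => (1 : ℝ))
  simp only [Finset.prod_const_one, mul_one, hf.sum_eq_one] at h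
  have := prodExp_const_mul f c (fun _ => 1)
  simpa [h] using this

lemma prodProb_mono {s t : (α → β) → Prop} (h : ∀ y, s y → t y) :
    prodProb f s ≤ prodProb f t :=
  hf.prodExp_mono fun y => ind_mono (h y)

lemma prodProb_le_one (s : (α → β) → Prop) : prodProb f s ≤ 1 :=
  (hf.prodExp_mono fun _ => ind_le_one _).trans_eq (hf.prodExp_const 1)

/-- Markov's inequality. -/
lemma prodProb_le_div {s : (α → β) → Prop} {F : (α → β) → ℝ} {c : ℝ} (hc : 0 < c)
    (h0 : ∀ y, 0 ≤ F y) (h : ∀ y, s y → c ≤ F y) : prodProb f s ≤ prodExp f F / c := by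
  rw [le_div_iff₀ hc, mul_comm, prodProb, ← prodExp_const_mul]
  refine hf.prodExp_mono fun y => ?_
  by_cases hs : s y
  · rw [ind_of hs, mul_one]; exact h y hs
  · rw [ind_of_not hs, mul_zero]; exact h0 y

lemma prodExp_prod_subset (A : Finset α) (h : α → β → ℝ) :
    prodExp f (fun y => ∏ a ∈ A, h a (y a)) = ∏ a ∈ A, ∑ v, f a v * h a v := by
  have e := prodExp_prod f (fun a v => if a ∈ A then h a v else 1)
  simp only [Finset.prod_ite_mem, Finset.univ_inter] at e
  rw [e, ← Finset.prod_subset (Finset.subset_univ A)]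
  · exact Finset.prod_congr rfl fun a ha => by simp [ha]
  · intro a _ ha; simp [ha, hf.sum_eq_one]

lemma prodExp_coord (a : α) (h : β → ℝ) :
    prodExp f (fun y => h (y a)) = ∑ v, f a v * h v := by
  simpa using hf.prodExp_prod_subset {a} (fun _ => h)

lemma prodExp_coord_mul {a b : α} (hab : a ≠ b) (h : α → β → ℝ) :
    prodExp f (fun y => h a (y a) * h b (y b)) =
      (∑ v, f a v * h a v) * ∑ v, f b v * h b v := by
  have := hf.prodExp_prod_subset {a, b} h
  simpa [Finset.prod_pair hab] using this

lemma prodProb_coord_eq_le {p : ℝ} (hp : ∀ a v, f a v ≤ p) {a b : α} (hab : a ≠ b) :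
    prodProb f (fun y => y a = y b) ≤ p := by
  have e (y : α → β) : ind (y a = y b) = ∑ v, ind (y a = v) * ind (y b = v) := by
    rw [Finset.sum_eq_single (y a)]
    · rw [ind_of rfl, one_mul]; simp only [eq_comm]
    · intro v _ hv; rw [ind_of_not hv.symm, zero_mul]
    · simp
  have hs (c : α) (w : β) : ∑ v, f c v * ind (v = w) = f c w := by
    rw [Finset.sum_eq_single w]
    · rw [ind_of rfl, mul_one]
    · intro v _ hv; rw [ind_of_not hv, mul_zero]
    · simp
  simp only [prodProb, e, prodExp_sum]
  calc ∑ v, prodExp f (fun y => ind (y a = v) * ind (y b = v))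
      = ∑ v, f a v * f b v := by
        refine Finset.sum_congr rfl fun v _ => ?_
        rw [hf.prodExp_coord_mul hab (fun _ w => ind (w = v)), hs, hs]
    _ ≤ ∑ v, f a v * p := Finset.sum_le_sum fun v _ =>
        mul_le_mul_of_nonneg_left (hp b v) (hf.nonneg a v)
    _ = p := by rw [← Finset.sum_mul, hf.sum_eq_one, one_mul]

/-- The variance of a sum of independent `[0, 1]`-valued variables is at most its mean. -/
lemma prodExp_sub_sq_le (A : Finset α) {h : α → β → ℝ} (h0 : ∀ a v, 0 ≤ h a v)
    (h1 : ∀ a v, h a v ≤ 1) :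
    prodExp f (fun y => (∑ a ∈ A, h a (y a) - ∑ a ∈ A, ∑ v, f a v * h a v) ^ 2) ≤
      ∑ a ∈ A, ∑ v, f a v * h a v := by
  set m : α → ℝ := fun a => ∑ v, f a v * h a v with hm
  set c : α → β → ℝ := fun a v => h a v - m a with hc
  have hc0 (a : α) : ∑ v, f a v * c a v = 0 := by
    simp only [hc, mul_sub, Finset.sum_sub_distrib, ← Finset.sum_mul, hf.sum_eq_one, one_mul]
    simp [hm]
  have e (y : α → β) : (∑ a ∈ A, h a (y a) - ∑ a ∈ A, m a) ^ 2 =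
      ∑ a ∈ A, ∑ b ∈ A, c a (y a) * c b (y b) := by
    rw [← Finset.sum_sub_distrib, sq, Finset.sum_mul_sum]
  simp only [e, prodExp_sum]
  refine Finset.sum_le_sum fun a ha => ?_
  rw [Finset.sum_eq_single a]
  · have : prodExp f (fun y => c a (y a) * c a (y a)) = ∑ v, f a v * (c a v * c a v) :=
      hf.prodExp_coord a (fun v => c a v * c a v)
    rw [this]
    have e2 : ∑ v, f a v * (c a v * c a v) = ∑ v, f a v * (h a v * h a v) - m a * m a := by
      have : ∀ v, f a v * (c a v * c a v) =
          f a v * (h a v * h a v) - 2 * m a * (f a v * h a v) + m a * m a * f a v := by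
        intro v; simp only [hc]; ring
      simp only [this, Finset.sum_add_distrib, Finset.sum_sub_distrib, ← Finset.mul_sum,
        hf.sum_eq_one]
      have : ∑ v, f a v * h a v = m a := rfl
      rw [this]; ring
    rw [e2]
    have : ∑ v, f a v * (h a v * h a v) ≤ ∑ v, f a v * h a v :=
      Finset.sum_le_sum fun v _ => mul_le_mul_of_nonneg_left
        (mul_le_of_le_one_left (h0 a v) (h1 a v)) (hf.nonneg a v)
    nlinarith [mul_self_nonneg (m a)]
  · intro b _ hb
    rw [hf.prodExp_coord_mul hb.symm c, hc0, zero_mul]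
  · exact fun h => absurd ha h

end IsKernel

variable [DecidableEq β]

/-- The set of agents that are green after the agents moved to `y`, if `A` was green before. -/
def spread (A : Finset α) (y : α → β) : Finset α :=
  A ∪ Finset.univ.filter fun a => ∃ b ∈ A, y a = y b

omit [Fintype β] in
lemma spread_mono {A B : Finset α} (h : A ⊆ B) (y : α → β) : spread A y ⊆ spread B y := by
  intro a
  simp only [spread, Finset.mem_union, Finset.mem_filter, Finset.mem_univ, true_and]
  rintro (ha | ⟨b, hb, e⟩)
  · exact Or.inl (h ha)
  · exact Or.inr ⟨b, h hb, e⟩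

omit [Fintype β] in
lemma card_spread_merge (A : Finset α) (z y : α → β) :
    ((spread A fun a => if a ∈ A then z a else y a).card : ℝ) =
      A.card + ∑ a ∈ Aᶜ, ind (y a ∈ A.image z) := by
  have e : spread A (fun a => if a ∈ A then z a else y a) =
      A ∪ Aᶜ.filter fun a => y a ∈ A.image z := by
    ext a
    simp only [spread, Finset.mem_union, Finset.mem_filter, Finset.mem_univ, true_and,
      Finset.mem_compl, Finset.mem_image]
    by_cases ha : a ∈ A
    · simp [ha]
    · simp only [ha, false_or, if_false, not_false_eq_true, true_and]
      constructor
      · rintro ⟨b, hb, h⟩; exact ⟨b, hb, by simpa [hb] using h.symm⟩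
      · rintro ⟨b, hb, h⟩; exact ⟨b, hb, by simpa [hb] using h.symm⟩
  rw [e, Finset.card_union_of_disjoint]
  · push_cast
    congr 1
    rw [Finset.card_filter]
    push_cast
    exact Finset.sum_congr rfl fun a _ => by
      by_cases h : y a ∈ A.image z
      · rw [if_pos h, ind_of h]
      · rw [if_neg h, ind_of_not h]
  · exact Finset.disjoint_left.mpr fun a ha h => by
      simp [ha] at h

/-- The number of ordered pairs of distinct elements of `A` that are mapped to the same place. -/
noncomputable def collisions (A : Finset α) (y : α → β) : ℝ :=
  ∑ a ∈ A, ∑ b ∈ A.erase a, ind (y a = y b)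

omit [Fintype α] [Fintype β] [DecidableEq β] in
lemma collisions_nonneg (A : Finset α) (y : α → β) : 0 ≤ collisions A y :=
  Finset.sum_nonneg fun _ _ => Finset.sum_nonneg fun _ _ => ind_nonneg _

omit [Fintype α] [Fintype β] in
lemma card_sub_collisions_le (A : Finset α) (y : α → β) :
    (A.card : ℝ) - collisions A y ≤ (A.image y).card := by
  set C := A.filter fun a => ∃ b ∈ A.erase a, y a = y b
  have h1 : (C.card : ℝ) ≤ collisions A y := by
    rw [Finset.card_filter]
    push_cast
    refine Finset.sum_le_sum fun a _ => ?_
    split_ifs with h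
    · obtain ⟨b, hb, e⟩ := h
      rw [← ind_of e]
      exact Finset.single_le_sum (f := fun b => ind (y a = y b)) (fun _ _ => ind_nonneg _) hb
    · exact Finset.sum_nonneg fun _ _ => ind_nonneg _
  have h2 : (A \ C).card ≤ (A.image y).card := by
    rw [← Finset.card_image_of_injOn (s := A \ C) (f := y)]
    · exact Finset.card_le_card (Finset.image_subset_image Finset.sdiff_subset)
    · intro a ha b hb e
      by_contra hne
      simp only [Finset.coe_sdiff, Set.mem_sdiff, Finset.mem_coe] at ha hb
      exact ha.2 (Finset.mem_filter.mpr
        ⟨ha.1, b, Finset.mem_erase.mpr ⟨Ne.symm hne, hb.1⟩, e⟩)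
  have h3 : A.card ≤ C.card + (A \ C).card := by
    have hCA : C ⊆ A := Finset.filter_subset _ _
    have := Finset.card_sdiff_add_card_eq_card hCA
    omega
  have h4 : (A.card : ℝ) ≤ C.card + (A.image y).card := by
    exact_mod_cast h3.trans (Nat.add_le_add_left h2 _)
  linarith

omit [Fintype α] [Fintype β] in
/-- A place occupied by `N` agents accounts for `N * (N - 1)` collisions. -/
lemma sq_card_fiber_le (A : Finset α) (y : α → β) (v : β) :
    ((A.filter fun a => y a = v).card : ℝ) ^ 2 ≤ A.card + collisions A y := by
  set C := A.filter fun a => y a = v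
  have h : (C.card : ℝ) ^ 2 = ∑ a ∈ C, ∑ b ∈ C, ind (y a = y b) := by
    have : ∀ a ∈ C, ∑ b ∈ C, ind (y a = y b) = C.card := by
      intro a ha
      rw [Finset.sum_congr rfl (g := fun _ => (1 : ℝ))]
      · simp
      · intro b hb
        exact ind_of (((Finset.mem_filter.mp ha).2).trans (Finset.mem_filter.mp hb).2.symm)
    rw [Finset.sum_congr rfl this]
    simp [sq]
  have h2 : (A.card : ℝ) + collisions A y = ∑ a ∈ A, ∑ b ∈ A, ind (y a = y b) := by
    rw [collisions, Finset.card_eq_sum_ones]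
    push_cast
    rw [← Finset.sum_add_distrib]
    refine Finset.sum_congr rfl fun a ha => ?_
    rw [← Finset.add_sum_erase A _ ha, ind_of rfl]
  rw [h, h2]
  refine (Finset.sum_le_sum fun a _ => Finset.sum_le_sum_of_subset_of_nonneg
    (Finset.filter_subset _ _) fun _ _ _ => ind_nonneg _).trans ?_
  exact Finset.sum_le_sum_of_subset_of_nonneg (Finset.filter_subset _ _) fun _ _ _ =>
    Finset.sum_nonneg fun _ _ => ind_nonneg _

namespace IsKernel

variable {f : α → β → ℝ} (hf : IsKernel f)

include hf

omit [DecidableEq β] in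
lemma prodExp_collisions_le {p : ℝ} (hp0 : 0 ≤ p) (hp : ∀ a v, f a v ≤ p) (A : Finset α) :
    prodExp f (collisions A) ≤ (A.card : ℝ) ^ 2 * p := by
  have : prodExp f (collisions A) =
      ∑ a ∈ A, ∑ b ∈ A.erase a, prodProb f (fun y => y a = y b) := by
    simp only [prodProb, ← prodExp_sum]
    rfl
  rw [this]
  calc _ ≤ ∑ a ∈ A, ∑ b ∈ A.erase a, p :=
        Finset.sum_le_sum fun a _ => Finset.sum_le_sum fun b hb =>
          hf.prodProb_coord_eq_le hp (Finset.ne_of_mem_erase hb).symm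
    _ ≤ ∑ a ∈ A, ∑ b ∈ A, p :=
        Finset.sum_le_sum fun a _ => Finset.sum_le_sum_of_subset_of_nonneg
          (Finset.erase_subset _ _) fun _ _ _ => hp0
    _ = _ := by simp; ring

lemma prodProb_crowded_le {p M : ℝ} (hp0 : 0 ≤ p) (hp : ∀ a v, f a v ≤ p) (hM : 0 < M)
    (A : Finset α) :
    prodProb f (fun y => ∃ v, M ≤ (A.filter fun a => y a = v).card) ≤
      (A.card + (A.card : ℝ) ^ 2 * p) / M ^ 2 := by
  refine (hf.prodProb_le_div (c := M ^ 2) (F := fun y => A.card + collisions A y)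
    (by positivity) (fun y => by have := collisions_nonneg A y; positivity) ?_).trans ?_
  · rintro y ⟨v, hv⟩
    exact (pow_le_pow_left₀ hM.le hv 2).trans (sq_card_fiber_le A y v)
  · rw [prodExp_add, hf.prodExp_const]
    gcongr
    exact hf.prodExp_collisions_le hp0 hp A

omit [DecidableEq β] in
lemma prodProb_merge_le {s : (α → β) → Prop} {t : (α → β) → Prop} (A : Finset α) {ε : ℝ}
    (hε : 0 ≤ ε)
    (h : ∀ z, ¬ t z → prodProb f (fun y => s fun a => if a ∈ A then z a else y a) ≤ ε) :
    prodProb f s ≤ prodProb f t + ε := by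
  rw [prodProb, prodExp_merge hf A, ← hf.prodExp_const ε, prodProb, ← prodExp_add]
  refine hf.prodExp_mono fun z => ?_
  by_cases hz : t z
  · rw [ind_of hz]
    have := hf.prodProb_le_one (fun y => s fun a => if a ∈ A then z a else y a)
    unfold prodProb at this
    linarith
  · rw [ind_of_not hz, zero_add]
    exact h z hz

/-- Concentration of the number of green agents after one round. -/
lemma prodProb_spread_le {n δ s₀ : ℝ} (hn : 0 < n) (hδ : 0 < δ) (hδ1 : δ < 1)
    (hup : ∀ a v, f a v ≤ (1 + δ) / n)
    (hlow : ∀ a (S : Finset β), s₀ ≤ S.card → (1 - δ) * S.card / n ≤ ∑ v ∈ S, f a v)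
    (A : Finset α) (hA : 0 < A.card) (hs₀ : s₀ ≤ (1 - δ) * A.card)
    (hAk : (A.card : ℝ) ≤ δ * Fintype.card α) (hd : 1 ≤ δ * (Fintype.card α / n)) :
    prodProb f (fun y => ¬ ((1 - δ) ^ 4 * (Fintype.card α / n) * A.card ≤ (spread A y).card ∧
        ((spread A y).card : ℝ) ≤ (1 + δ) ^ 4 * (Fintype.card α / n) * A.card)) ≤
      2 * A.card / (δ * n) + 1 / (δ ^ 2 * ((1 - δ) ^ 3 * (Fintype.card α / n) * A.card)) := by
  set k : ℝ := (Fintype.card α : ℝ) with hk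
  set g : ℝ := (A.card : ℝ) with hg
  have hg0 : 0 < g := by rw [hg]; exact_mod_cast hA
  have h1δ : 0 < 1 - δ := by linarith
  have hk0 : 0 < k / n := by
    by_contra h
    push Not at h
    nlinarith
  have hm0 : 0 < (1 - δ) ^ 3 * (k / n) * g := by positivity
  refine (hf.prodProb_merge_le A (t := fun z => δ * g ≤ collisions A z)
    (ε := 1 / (δ ^ 2 * ((1 - δ) ^ 3 * (k / n) * g))) (by positivity) ?_).trans ?_
  · intro z hz
    push Not at hz
    set S := A.image z
    have hSg : (S.card : ℝ) ≤ g := Nat.cast_le.mpr Finset.card_image_le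
    have hSl : (1 - δ) * g ≤ S.card := by
      have := card_sub_collisions_le A z
      linarith
    set m := ∑ a ∈ Aᶜ, ∑ v, f a v * ind (v ∈ S) with hm
    have hfS (a : α) : ∑ v, f a v * ind (v ∈ S) = ∑ v ∈ S, f a v := by
      rw [← Finset.sum_subset (Finset.subset_univ S)]
      · exact Finset.sum_congr rfl fun v hv => by rw [ind_of hv, mul_one]
      · intro v _ hv; rw [ind_of_not hv, mul_zero]
    have hAc : ((Aᶜ).card : ℝ) = k - g := by
      rw [Finset.card_compl, Nat.cast_sub (Finset.card_le_univ A)]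
    have hml : (1 - δ) ^ 3 * (k / n) * g ≤ m := by
      have h1 : ∀ a ∈ Aᶜ, (1 - δ) * S.card / n ≤ ∑ v, f a v * ind (v ∈ S) := by
        intro a _
        rw [hfS]
        exact hlow a S (hs₀.trans hSl)
      have h2 := Finset.card_nsmul_le_sum _ _ _ h1
      rw [nsmul_eq_mul, hAc] at h2
      refine le_trans ?_ h2
      have : (1 - δ) * k ≤ k - g := by linarith
      calc (1 - δ) ^ 3 * (k / n) * g = ((1 - δ) * k) * ((1 - δ) * ((1 - δ) * g) / n) := by ring
        _ ≤ (k - g) * ((1 - δ) * S.card / n) := by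
          have hk' : 0 ≤ k := by positivity
          have : 0 ≤ k - g := le_trans (by positivity) this
          gcongr
    have hmu : m ≤ (1 + δ) * (k / n) * g := by
      have h1 : ∀ a ∈ Aᶜ, ∑ v, f a v * ind (v ∈ S) ≤ g * ((1 + δ) / n) := by
        intro a _
        rw [hfS]
        have := Finset.sum_le_card_nsmul S (f a) _ fun v _ => hup a v
        rw [nsmul_eq_mul] at this
        exact this.trans (by gcongr)
      have h2 := Finset.sum_le_card_nsmul _ _ _ h1
      rw [nsmul_eq_mul, hAc] at h2
      refine h2.trans ?_
      calc (k - g) * (g * ((1 + δ) / n)) ≤ k * (g * ((1 + δ) / n)) := by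
            gcongr; linarith
        _ = _ := by ring
    have hmpos : 0 < m := lt_of_lt_of_le hm0 hml
    have hcheb := hf.prodExp_sub_sq_le Aᶜ (h := fun _ v => ind (v ∈ S))
      (fun _ _ => ind_nonneg _) (fun _ _ => ind_le_one _)
    rw [← hm] at hcheb
    refine (hf.prodProb_le_div (c := (δ * m) ^ 2) (by positivity)
      (F := fun y => (∑ a ∈ Aᶜ, ind (y a ∈ S) - m) ^ 2) (fun y => sq_nonneg _) ?_).trans ?_
    · intro y hy
      rw [card_spread_merge] at hy
      set X := ∑ a ∈ Aᶜ, ind (y a ∈ S) with hX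
      by_contra hlt
      push Not at hlt
      have habs := abs_lt_of_sq_lt_sq hlt (by positivity)
      rw [abs_lt] at habs
      apply hy
      constructor
      · have : (1 - δ) * ((1 - δ) ^ 3 * (k / n) * g) ≤ (1 - δ) * m := by gcongr
        nlinarith
      · have h3 : (1 + δ) * m ≤ (1 + δ) * ((1 + δ) * (k / n) * g) := by gcongr
        have h4 : g ≤ δ * (k / n) * g := by nlinarith
        have h5 : (1 + δ) ^ 2 + δ ≤ (1 + δ) ^ 4 := by
          nlinarith [pow_pos hδ 3, pow_pos hδ 4, pow_pos hδ 2]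
        have h6 : ((1 + δ) ^ 2 + δ) * ((k / n) * g) ≤ (1 + δ) ^ 4 * ((k / n) * g) := by gcongr
        nlinarith
    · calc _ ≤ m / (δ * m) ^ 2 := by gcongr
        _ = 1 / (δ ^ 2 * m) := by field_simp
        _ ≤ _ := by gcongr
  · gcongr
    refine (hf.prodProb_le_div (c := δ * g) (by positivity) (collisions_nonneg A)
      fun _ h => h).trans ?_
    calc _ ≤ (g ^ 2 * ((1 + δ) / n)) / (δ * g) := by
          gcongr
          exact hf.prodExp_collisions_le (by positivity) hup A
      _ = (1 + δ) * g / (δ * n) := by field_simp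
      _ ≤ 2 * g / (δ * n) := by gcongr; linarith

omit [DecidableEq β] in
lemma prodExp_prod_ind_ne (A : Finset α) (v : β) :
    prodExp f (fun y => ∏ a ∈ A, ind (y a ≠ v)) = ∏ a ∈ A, (1 - f a v) := by
  rw [hf.prodExp_prod_subset A (fun _ w => ind (w ≠ v))]
  refine Finset.prod_congr rfl fun a _ => ?_
  simp only [ne_eq, ind_not, mul_sub, mul_one, Finset.sum_sub_distrib, hf.sum_eq_one]
  rw [Finset.sum_eq_single v, ind_of rfl, mul_one]
  · intro w _ hw; rw [ind_of_not hw, mul_zero]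
  · simp

omit [DecidableEq β] [DecidableEq α] [Fintype α] in
lemma le_one (a : α) (v : β) : f a v ≤ 1 := by
  have := Finset.single_le_sum (fun w _ => hf.nonneg a w) (Finset.mem_univ v)
  rwa [hf.sum_eq_one] at this

/-- If the expected number of agents of `A` moving to any given vertex is at least `g`, then it is
unlikely that some vertex is missed. -/
lemma prodProb_spread_ne_univ_le {q g : ℝ}
    (A : Finset α) (hA : ∀ v, g ≤ ∑ a ∈ A, f a v) (hq : Fintype.card β ≤ q) :
    prodProb f (fun y => spread A y ≠ Finset.univ) ≤ q * Real.exp (-g) := by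
  have h1 (y : α → β) : ind (spread A y ≠ Finset.univ) ≤ ∑ v, ∏ a ∈ A, ind (y a ≠ v) := by
    by_cases h : spread A y = Finset.univ
    · rw [ind_of_not (by simpa using h)]
      exact Finset.sum_nonneg fun _ _ => Finset.prod_nonneg fun _ _ => ind_nonneg _
    · obtain ⟨a, ha⟩ : ∃ a, a ∉ spread A y := by
        by_contra! hc
        exact h (Finset.eq_univ_of_forall hc)
      have e : ∏ b ∈ A, ind (y b ≠ y a) = 1 := Finset.prod_eq_one fun b hb => by
        refine ind_of fun hba => ha ?_
        simp only [spread, Finset.mem_union, Finset.mem_filter, Finset.mem_univ, true_and]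
        exact Or.inr ⟨b, hb, hba.symm⟩
      rw [ind_of h, ← e]
      exact Finset.single_le_sum (f := fun v => ∏ b ∈ A, ind (y b ≠ v))
        (fun _ _ => Finset.prod_nonneg fun _ _ => ind_nonneg _) (Finset.mem_univ _)
  refine (hf.prodExp_mono h1).trans ?_
  rw [prodExp_sum]
  have h2 : ∀ v ∈ (Finset.univ : Finset β),
      prodExp f (fun y => ∏ a ∈ A, ind (y a ≠ v)) ≤ Real.exp (-g) := by
    intro v _
    rw [hf.prodExp_prod_ind_ne A v]
    calc ∏ a ∈ A, (1 - f a v) ≤ ∏ a ∈ A, Real.exp (-f a v) :=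
          Finset.prod_le_prod (fun a _ => sub_nonneg.mpr (hf.le_one a v))
            fun a _ => Real.one_sub_le_exp_neg _
      _ = Real.exp (-∑ a ∈ A, f a v) := by rw [← Real.exp_sum, Finset.sum_neg_distrib]
      _ ≤ _ := Real.exp_le_exp.mpr (neg_le_neg (hA v))
  refine (Finset.sum_le_card_nsmul _ _ _ h2).trans ?_
  rw [nsmul_eq_mul, Finset.card_univ]
  gcongr

/-- Second moment bound: some vertex is missed by `A` as soon as the expected number of missed
vertices is large. -/
lemma prodProb_image_eq_univ_le (A : Finset α) {E : ℝ} (hE : 0 < E)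
    (h : E ≤ ∑ v, ∏ a ∈ A, (1 - f a v)) :
    prodProb f (fun y => ∀ v, ∃ a ∈ A, y a = v) ≤ 1 / E := by
  set U : (α → β) → ℝ := fun y => ∑ v, ∏ a ∈ A, ind (y a ≠ v) with hU
  set m := ∑ v, ∏ a ∈ A, (1 - f a v) with hm
  have hm0 : 0 < m := hE.trans_le h
  have hle := hf.le_one
  have hEU : prodExp f U = m := by
    rw [hU, prodExp_sum]
    exact Finset.sum_congr rfl fun v _ => hf.prodExp_prod_ind_ne A v
  have hpair (u v : β) : prodExp f (fun y => (∏ a ∈ A, ind (y a ≠ u)) * ∏ a ∈ A, ind (y a ≠ v))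
      ≤ (if u = v then ∏ a ∈ A, (1 - f a u) else 0) +
        (∏ a ∈ A, (1 - f a u)) * ∏ a ∈ A, (1 - f a v) := by
    have hnn (w : β) : 0 ≤ ∏ a ∈ A, (1 - f a w) :=
      Finset.prod_nonneg fun a _ => sub_nonneg.mpr (hle a w)
    split_ifs with huv
    · subst huv
      have : ∀ y : α → β, (∏ a ∈ A, ind (y a ≠ u)) * ∏ a ∈ A, ind (y a ≠ u) ≤
          ∏ a ∈ A, ind (y a ≠ u) := fun y =>
        mul_le_of_le_one_left (Finset.prod_nonneg fun _ _ => ind_nonneg _)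
          (Finset.prod_le_one (fun _ _ => ind_nonneg _) fun _ _ => ind_le_one _)
      refine (hf.prodExp_mono this).trans ?_
      rw [hf.prodExp_prod_ind_ne]
      nlinarith [hnn u, mul_self_nonneg (∏ a ∈ A, (1 - f a u))]
    · simp only [← Finset.prod_mul_distrib]
      rw [hf.prodExp_prod_subset A (fun _ w => ind (w ≠ u) * ind (w ≠ v)), zero_add]
      refine Finset.prod_le_prod (fun a _ => Finset.sum_nonneg fun w _ =>
        mul_nonneg (hf.nonneg a w) (mul_nonneg (ind_nonneg _) (ind_nonneg _))) fun a _ => ?_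
      have e : ∑ w, f a w * (ind (w ≠ u) * ind (w ≠ v)) = 1 - f a u - f a v := by
        have : ∀ w, f a w * (ind (w ≠ u) * ind (w ≠ v)) =
            f a w - f a w * ind (w = u) - f a w * ind (w = v) := by
          intro w
          by_cases h1 : w = u
          · have h2 : w ≠ v := fun h2 => huv (h1.symm.trans h2)
            simp [ind, h1, huv]
          · by_cases h2 : w = v
            · have h3 : v ≠ u := fun h3 => huv h3.symm
              simp [ind, h2, h3]
            · simp [ind, h1, h2]
        have hs (c : β) : ∑ w, f a w * ind (w = c) = f a c := by
          rw [Finset.sum_eq_single c, ind_of rfl, mul_one]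
          · intro w _ hw; rw [ind_of_not hw, mul_zero]
          · simp
        simp only [this, Finset.sum_sub_distrib, hs, hf.sum_eq_one]
      rw [e]
      nlinarith [mul_nonneg (hf.nonneg a u) (hf.nonneg a v)]
  have hvar : prodExp f (fun y => (U y - m) ^ 2) ≤ m := by
    have e (y : α → β) : (U y - m) ^ 2 =
        (∑ u, ∑ v, (∏ a ∈ A, ind (y a ≠ u)) * ∏ a ∈ A, ind (y a ≠ v)) - 2 * m * U y + m ^ 2 := by
      rw [← Finset.sum_mul_sum]
      simp only [hU]
      ring
    simp only [e]
    rw [prodExp_add, prodExp_sub, prodExp_const_mul, hEU, hf.prodExp_const, prodExp_sum]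
    simp only [prodExp_sum]
    have : ∑ u, ∑ v, prodExp f (fun y => (∏ a ∈ A, ind (y a ≠ u)) * ∏ a ∈ A, ind (y a ≠ v))
        ≤ m + m * m := by
      refine (Finset.sum_le_sum fun u _ => Finset.sum_le_sum fun v _ => hpair u v).trans_eq ?_
      simp only [Finset.sum_add_distrib, Finset.sum_ite_eq, Finset.mem_univ, if_true,
        ← Finset.mul_sum, ← Finset.sum_mul]
      rfl
    linarith
  refine (hf.prodProb_le_div (c := m ^ 2) (F := fun y => (U y - m) ^ 2) (by positivity)
    (fun _ => sq_nonneg _) ?_).trans ?_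
  · intro y hy
    have : U y = 0 := Finset.sum_eq_zero fun v _ => by
      obtain ⟨a, ha, hav⟩ := hy v
      exact Finset.prod_eq_zero ha (ind_of_not (by simpa using hav))
    simp [this]
  · calc _ ≤ m / m ^ 2 := by gcongr
      _ = 1 / m := by field_simp
      _ ≤ _ := by gcongr

lemma prodProb_spread_eq_univ_le (A : Finset α) {E g : ℝ} (hE : 0 < E)
    (h : E ≤ ∑ v, ∏ a ∈ A, (1 - f a v)) (hA : ∀ v, g ≤ ∑ a ∈ Aᶜ, f a v) :
    prodProb f (fun y => spread A y = Finset.univ) ≤ 1 / E + Real.exp (-g) := by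
  refine (hf.prodProb_merge_le A (t := fun y => ∀ v, ∃ a ∈ A, y a = v) (Real.exp_pos _).le
    ?_).trans (add_le_add_left (hf.prodProb_image_eq_univ_le A hE h) _)
  intro z hz
  push Not at hz
  obtain ⟨v, hv⟩ := hz
  have hle (y : α → β) :
      ind ((spread A fun a => if a ∈ A then z a else y a) = Finset.univ) ≤
        ∏ a ∈ Aᶜ, ind (y a ≠ v) := by
    by_cases hy : (spread A fun a => if a ∈ A then z a else y a) = Finset.univ
    · rw [ind_of hy, Finset.prod_eq_one]
      intro a ha
      refine ind_of fun hav => ?_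
      have := hy ▸ Finset.mem_univ a
      simp only [spread, Finset.mem_union, Finset.mem_filter, Finset.mem_univ, true_and] at this
      have ha' : a ∉ A := Finset.mem_compl.mp ha
      rcases this with h | ⟨b, hb, e⟩
      · exact ha' h
      · rw [if_neg ha', if_pos hb, hav] at e
        exact hv b hb e.symm
    · rw [ind_of_not hy]
      exact Finset.prod_nonneg fun _ _ => ind_nonneg _
  refine (hf.prodExp_mono hle).trans ?_
  rw [hf.prodExp_prod_ind_ne]
  calc _ ≤ ∏ a ∈ Aᶜ, Real.exp (-f a v) := Finset.prod_le_prod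
            (fun a _ => by
              have := Finset.single_le_sum (fun w _ => hf.nonneg a w) (Finset.mem_univ v)
              rw [hf.sum_eq_one] at this
              linarith)
            fun a _ => Real.one_sub_le_exp_neg _
      _ = Real.exp (-∑ a ∈ Aᶜ, f a v) := by rw [← Real.exp_sum, Finset.sum_neg_distrib]
      _ ≤ _ := Real.exp_le_exp.mpr (neg_le_neg (hA v))

end IsKernel

end ProductWeights

section Trajectories

variable {n k : ℕ}

/-- The transition weights of agents at positions `x`. -/
noncomputable def stepKer (x : Fin k → Fin n) : Fin k → Fin n → ℝ :=
  fun a v => if v = x a then 0 else ((n : ℝ) - 1)⁻¹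

lemma sum_stepKer (x : Fin k → Fin n) (a : Fin k) (S : Finset (Fin n)) :
    ∑ v ∈ S, stepKer x a v = ((S.erase (x a)).card : ℝ) * ((n : ℝ) - 1)⁻¹ := by
  simp only [stepKer]
  rw [Finset.sum_ite, Finset.sum_const_zero, zero_add, Finset.sum_const, nsmul_eq_mul,
    Finset.filter_ne']

lemma isKernel_stepKer (hn : 2 ≤ n) (x : Fin k → Fin n) : IsKernel (stepKer x) where
  nonneg a v := by
    have : (2 : ℝ) ≤ n := by exact_mod_cast hn
    unfold stepKer
    split_ifs
    · exact le_rfl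
    · exact inv_nonneg.mpr (by linarith)
  sum_eq_one a := by
    have : (2 : ℝ) ≤ n := by exact_mod_cast hn
    rw [sum_stepKer, Finset.card_erase_of_mem (Finset.mem_univ _), Finset.card_univ,
      Fintype.card_fin, Nat.cast_sub (by omega), Nat.cast_one]
    exact mul_inv_cancel₀ (by linarith)

lemma stepKer_le (hn : 2 ≤ n) (x : Fin k → Fin n) (a : Fin k) (v : Fin n) :
    stepKer x a v ≤ ((n : ℝ) - 1)⁻¹ := by
  have : (2 : ℝ) ≤ n := by exact_mod_cast hn
  unfold stepKer
  split_ifs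
  · exact inv_nonneg.mpr (by linarith)
  · exact le_rfl

/-- The uniform initial weights. -/
noncomputable def unifKer (n k : ℕ) : Fin k → Fin n → ℝ := fun _ _ => (n : ℝ)⁻¹

lemma isKernel_unifKer (hn : 2 ≤ n) : IsKernel (unifKer n k) where
  nonneg _ _ := by unfold unifKer; positivity
  sum_eq_one _ := by
    have : (2 : ℝ) ≤ n := by exact_mod_cast hn
    simp only [unifKer, Finset.sum_const, Finset.card_univ, Fintype.card_fin, nsmul_eq_mul]
    exact mul_inv_cancel₀ (by linarith)

/-- Extension of a trajectory prefix to all times, constant from time `T` on. -/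
def extendTraj {T : ℕ} (p : Fin (T + 1) → Fin k → Fin n) : ℕ → Fin k → Fin n :=
  fun t a => p ⟨min t T, Nat.lt_succ_of_le (min_le_right t T)⟩ a

lemma greenSet_congr {p q : ℕ → Fin k → Fin n} {T : ℕ} (h : ∀ t ≤ T, p t = q t) :
    greenSet n k p T = greenSet n k q T := by
  induction T with
  | zero => simp only [greenSet, h 0 le_rfl]
  | succ T ih =>
    have e := ih fun t ht => h t (ht.trans T.le_succ)
    simp only [greenSet, h (T + 1) le_rfl, e]

lemma greenSet_succ (p : ℕ → Fin k → Fin n) (T : ℕ) :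
    greenSet n k p (T + 1) = spread (greenSet n k p T) (p (T + 1)) := by
  ext a
  simp [greenSet, spread]

/-- The expectation of a function of the positions and the green set at time `T`. -/
noncomputable def trajExp (n k T : ℕ) (Φ : (Fin k → Fin n) → Finset (Fin k) → ℝ) : ℝ :=
  ∑ p : Fin (T + 1) → Fin k → Fin n,
    prefixProb n k T p * Φ (p (Fin.last T)) (greenSet n k (extendTraj p) T)

/-- The probability of an event depending on the positions and the green set at time `T`. -/
noncomputable def trajProb (n k T : ℕ) (B : (Fin k → Fin n) → Finset (Fin k) → Prop) : ℝ :=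
  trajExp n k T fun x G => ind (B x G)

lemma probXiLe_eq_trajProb (n k T : ℕ) :
    probXiLe n k T = trajProb n k T fun _ G => G = Finset.univ := by
  unfold probXiLe trajProb trajExp
  refine Finset.sum_congr rfl fun p _ => ?_
  change (if greenSet n k (extendTraj p) T = Finset.univ then _ else _) =
    prefixProb n k T p * ind (greenSet n k (extendTraj p) T = Finset.univ)
  split_ifs with h
  · rw [ind_of h, mul_one]
  · rw [ind_of_not h, mul_zero]

lemma trajExp_zero (hk : 0 < k) (Φ : (Fin k → Fin n) → Finset (Fin k) → ℝ) :
    trajExp n k 0 Φ = prodExp (unifKer n k) fun y => Φ y (spread {⟨0, hk⟩} y) := by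
  unfold trajExp prodExp
  refine Fintype.sum_equiv (Equiv.funUnique (Fin 1) (Fin k → Fin n)) _ _ fun p => ?_
  have e : greenSet n k (extendTraj p) 0 = spread {⟨0, hk⟩} (p 0) := by
    ext a
    simp only [greenSet, spread, Finset.mem_filter, Finset.mem_univ, true_and, Finset.mem_union,
      Finset.mem_singleton, exists_eq_left]
    constructor
    · rintro ⟨b, hb, h⟩
      obtain rfl : b = ⟨0, hk⟩ := Fin.ext hb
      exact Or.inr h
    · rintro (rfl | h)
      · exact ⟨_, rfl, rfl⟩
      · exact ⟨_, rfl, h⟩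
  rw [e]
  simp [prefixProb, unifKer, Equiv.funUnique]

lemma trajExp_succ (T : ℕ) (Φ : (Fin k → Fin n) → Finset (Fin k) → ℝ) :
    trajExp n k (T + 1) Φ =
      trajExp n k T fun x G => prodExp (stepKer x) fun y => Φ y (spread G y) := by
  unfold trajExp prodExp
  simp only [Finset.mul_sum]
  rw [← Fintype.sum_prod_type']
  rw [← (Fin.snocEquiv (fun _ : Fin (T + 2) => Fin k → Fin n)).sum_comp,
    ← (Equiv.prodComm _ _).sum_comp]
  refine Finset.sum_congr rfl fun q _ => ?_
  obtain ⟨p, y⟩ := q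
  have hs : (Fin.snocEquiv (fun _ : Fin (T + 2) => Fin k → Fin n)) (y, p) =
      Fin.snoc (α := fun _ => Fin k → Fin n) p y := rfl
  simp only [Equiv.prodComm_apply, Prod.swap_prod_mk, hs, Fin.snoc_last]
  have hw : prefixProb n k (T + 1) (Fin.snoc (α := fun _ => Fin k → Fin n) p y) =
      prefixProb n k T p * ∏ a, stepKer (p (Fin.last T)) a (y a) := by
    unfold prefixProb
    rw [← Finset.prod_mul_distrib]
    refine Finset.prod_congr rfl fun a _ => ?_
    rw [Fin.prod_univ_castSucc, mul_assoc]
    congr 2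
    · refine Finset.prod_congr rfl fun t _ => ?_
      rw [Fin.succ_castSucc, Fin.snoc_castSucc, Fin.snoc_castSucc]
    · rw [Fin.succ_last, Fin.snoc_last, Fin.snoc_castSucc]
      rfl
  have hg : greenSet n k (extendTraj (Fin.snoc (α := fun _ => Fin k → Fin n) p y)) (T + 1) =
      spread (greenSet n k (extendTraj p) T) y := by
    have e1 : greenSet n k (extendTraj (Fin.snoc (α := fun _ => Fin k → Fin n) p y)) T =
        greenSet n k (extendTraj p) T := by
      refine greenSet_congr fun t ht => ?_
      funext a
      simp only [extendTraj]
      have : (⟨min t (T + 1), Nat.lt_succ_of_le (min_le_right t (T + 1))⟩ : Fin (T + 2)) =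
          Fin.castSucc ⟨min t T, Nat.lt_succ_of_le (min_le_right t T)⟩ := by
        ext
        simp only [Fin.val_castSucc]
        omega
      rw [this, Fin.snoc_castSucc]
    have e2 : extendTraj (Fin.snoc (α := fun _ => Fin k → Fin n) p y) (T + 1) = y := by
      funext a
      simp only [extendTraj]
      have : (⟨min (T + 1) (T + 1), Nat.lt_succ_of_le (min_le_right (T + 1) (T + 1))⟩ :
          Fin (T + 2)) = Fin.last (T + 1) := by
        ext
        simp
      rw [this, Fin.snoc_last]
    rw [greenSet_succ, e2, e1]
  rw [hw, hg, mul_assoc]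

lemma prefixProb_nonneg (hn : 2 ≤ n) (T : ℕ) (p : Fin (T + 1) → Fin k → Fin n) :
    0 ≤ prefixProb n k T p := by
  have : (2 : ℝ) ≤ n := by exact_mod_cast hn
  refine Finset.prod_nonneg fun a _ => mul_nonneg (by positivity) (Finset.prod_nonneg fun t _ => ?_)
  split_ifs
  · exact le_rfl
  · exact inv_nonneg.mpr (by linarith)

lemma trajExp_mono (hn : 2 ≤ n) {T : ℕ} {Φ Ψ : (Fin k → Fin n) → Finset (Fin k) → ℝ}
    (h : ∀ x G, Φ x G ≤ Ψ x G) : trajExp n k T Φ ≤ trajExp n k T Ψ :=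
  Finset.sum_le_sum fun p _ => mul_le_mul_of_nonneg_left (h _ _) (prefixProb_nonneg hn T p)

lemma trajExp_add (T : ℕ) (Φ Ψ : (Fin k → Fin n) → Finset (Fin k) → ℝ) :
    trajExp n k T (fun x G => Φ x G + Ψ x G) = trajExp n k T Φ + trajExp n k T Ψ := by
  simp [trajExp, mul_add, Finset.sum_add_distrib]

lemma trajExp_const (hn : 2 ≤ n) (hk : 0 < k) (T : ℕ) (c : ℝ) :
    trajExp n k T (fun _ _ => c) = c := by
  induction T with
  | zero => rw [trajExp_zero hk, (isKernel_unifKer hn).prodExp_const]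
  | succ T ih =>
    rw [trajExp_succ]
    simp only [(isKernel_stepKer hn _).prodExp_const, ih]

lemma trajProb_nonneg (hn : 2 ≤ n) (T : ℕ) (B : (Fin k → Fin n) → Finset (Fin k) → Prop) :
    0 ≤ trajProb n k T B :=
  Finset.sum_nonneg fun p _ => mul_nonneg (prefixProb_nonneg hn T p) (ind_nonneg _)

lemma trajProb_mono (hn : 2 ≤ n) {T : ℕ} {B C : (Fin k → Fin n) → Finset (Fin k) → Prop}
    (h : ∀ x G, B x G → C x G) : trajProb n k T B ≤ trajProb n k T C :=
  trajExp_mono hn fun x G => ind_mono (h x G)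

lemma trajProb_or_le (hn : 2 ≤ n) (T : ℕ) (B C : (Fin k → Fin n) → Finset (Fin k) → Prop) :
    trajProb n k T (fun x G => B x G ∨ C x G) ≤ trajProb n k T B + trajProb n k T C := by
  unfold trajProb
  rw [← trajExp_add]
  exact trajExp_mono hn fun x G => ind_or_le _ _

lemma trajProb_not (hn : 2 ≤ n) (hk : 0 < k) (T : ℕ)
    (B : (Fin k → Fin n) → Finset (Fin k) → Prop) :
    trajProb n k T (fun x G => ¬ B x G) = 1 - trajProb n k T B := by
  have h := trajExp_add T (fun x G => ind (¬ B x G)) (fun x G => ind (B x G))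
  have e : ∀ x G, ind (¬ B x G) + ind (B x G) = 1 := fun x G => by rw [ind_not]; ring
  simp only [e, trajExp_const hn hk] at h
  unfold trajProb
  linarith

/-- One round of the process: if from every good state the event `C` has probability at most `ε`
one round later, then `C` is at most `ε` more likely than a bad state. -/
lemma trajProb_succ_le (hn : 2 ≤ n) (hk : 0 < k) (T : ℕ)
    (B C : (Fin k → Fin n) → Finset (Fin k) → Prop) {ε : ℝ} (hε : 0 ≤ ε)
    (h : ∀ x G, ¬ B x G → prodProb (stepKer x) (fun y => C y (spread G y)) ≤ ε) :
    trajProb n k (T + 1) C ≤ trajProb n k T B + ε := by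
  unfold trajProb
  rw [trajExp_succ, ← trajExp_const hn hk T ε, ← trajExp_add]
  refine trajExp_mono hn fun x G => ?_
  by_cases hB : B x G
  · rw [ind_of hB]
    have := (isKernel_stepKer hn x).prodProb_le_one (fun y => C y (spread G y))
    unfold prodProb at this
    linarith
  · rw [ind_of_not hB, zero_add]
    exact h x G hB

lemma trajProb_zero (hk : 0 < k) (B : (Fin k → Fin n) → Finset (Fin k) → Prop) :
    trajProb n k 0 B = prodProb (unifKer n k) fun y => B y (spread {⟨0, hk⟩} y) :=
  trajExp_zero hk _

lemma probXiMem_singleton_succ (n k t : ℕ) :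
    probXiMem n k {t + 1} = probXiLe n k (t + 1) - probXiLe n k t := by
  rw [probXiMem, tsum_eq_single (t + 1)]
  · rw [Set.indicator_of_mem (Set.mem_singleton _)]
    rfl
  · intro s hs
    exact Set.indicator_of_notMem (by simpa using hs) _

lemma probXiMem_pair_succ (n k t : ℕ) :
    probXiMem n k {t + 1, t + 2} = probXiLe n k (t + 2) - probXiLe n k t := by
  rw [probXiMem, tsum_eq_sum (s := {t + 1, t + 2})]
  · rw [Finset.sum_pair (by omega), Set.indicator_of_mem (by simp),
      Set.indicator_of_mem (by simp)]
    simp only [probXiEq]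
    ring
  · intro s hs
    exact Set.indicator_of_notMem (by simpa using hs) _

end Trajectories

section Rounds

variable {n k : ℕ}

lemma stepKer_le_div (hn : 2 ≤ n) {δ : ℝ} (hδ : 0 < δ) (hδ1 : δ < 1) (hnδ : 2 / δ ≤ n)
    (x : Fin k → Fin n) (a : Fin k) (v : Fin n) : stepKer x a v ≤ (1 + δ) / n := by
  have h2 : (2 : ℝ) ≤ n := by exact_mod_cast hn
  refine (stepKer_le hn x a v).trans ?_
  rw [div_le_iff₀ hδ] at hnδ
  rw [inv_eq_one_div, div_le_div_iff₀ (by linarith) (by linarith)]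
  nlinarith

lemma div_le_sum_stepKer (hn : 2 ≤ n) {δ : ℝ} (hδ : 0 < δ) (x : Fin k → Fin n) (a : Fin k)
    (S : Finset (Fin n)) (hS : 1 / δ ≤ S.card) :
    (1 - δ) * S.card / n ≤ ∑ v ∈ S, stepKer x a v := by
  have h2 : (2 : ℝ) ≤ n := by exact_mod_cast hn
  have h1 : (S.card : ℝ) - 1 ≤ (S.erase (x a)).card := by
    have := Finset.pred_card_le_card_erase (s := S) (a := x a)
    have : S.card ≤ (S.erase (x a)).card + 1 := by omega
    have : (S.card : ℝ) ≤ (S.erase (x a)).card + 1 := by exact_mod_cast this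
    linarith
  rw [div_le_iff₀ hδ] at hS
  rw [sum_stepKer, ← div_eq_mul_inv]
  calc (1 - δ) * S.card / n ≤ ((S.erase (x a)).card : ℝ) / n := by gcongr; nlinarith
    _ ≤ _ := by
      apply div_le_div_of_nonneg_left <;> first | positivity | linarith

/-- Concentration of the number of green agents around powers of the density `d`. -/
def Concentrated (δ d : ℝ) (m : ℕ) (G : Finset (Fin k)) : Prop :=
  (1 - δ) ^ (4 * m) * d ^ m ≤ G.card ∧ (G.card : ℝ) ≤ (1 + δ) ^ (4 * m) * d ^ m

lemma prodProb_spread_stepKer_le (hn : 2 ≤ n) {δ : ℝ} (hδ : 0 < δ) (hδ1 : δ < 1)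
    (hnδ : 2 / δ ≤ n) (x : Fin k → Fin n) (A : Finset (Fin k))
    (hA : 1 / δ ≤ (1 - δ) * A.card) (hAk : (A.card : ℝ) ≤ δ * k)
    (hd : 1 ≤ δ * ((k : ℝ) / n)) :
    prodProb (stepKer x) (fun y => ¬ ((1 - δ) ^ 4 * ((k : ℝ) / n) * A.card ≤ (spread A y).card ∧
        ((spread A y).card : ℝ) ≤ (1 + δ) ^ 4 * ((k : ℝ) / n) * A.card)) ≤
      2 * A.card / (δ * n) + 1 / (δ ^ 2 * ((1 - δ) ^ 3 * ((k : ℝ) / n) * A.card)) := by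
  have h2 : (2 : ℝ) ≤ n := by exact_mod_cast hn
  have hpos : 0 < A.card := by
    rcases Nat.eq_zero_or_pos A.card with h | h
    · have : 0 < 1 / δ := by positivity
      rw [h] at hA
      simp at hA
      linarith
    · exact h
  have := (isKernel_stepKer hn x).prodProb_spread_le (n := n) (s₀ := 1 / δ) (by linarith) hδ hδ1
    (stepKer_le_div hn hδ hδ1 hnδ x) (div_le_sum_stepKer hn hδ x) A hpos hA
    (by rwa [Fintype.card_fin]) (by rwa [Fintype.card_fin])
  rwa [Fintype.card_fin] at this

lemma prodProb_spread_unifKer_le (hn : 2 ≤ n) {δ : ℝ} (hδ : 0 < δ) (hδ1 : δ < 1)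
    (a : Fin k) (hd : 1 ≤ δ * ((k : ℝ) / n)) :
    prodProb (unifKer n k) (fun y => ¬ Concentrated δ ((k : ℝ) / n) 1 (spread {a} y)) ≤
      2 / (δ * n) + 1 / (δ ^ 2 * ((1 - δ) ^ 3 * ((k : ℝ) / n))) := by
  have h2 : (2 : ℝ) ≤ n := by exact_mod_cast hn
  have hk : (1 : ℝ) ≤ δ * k := by
    refine hd.trans ?_
    have : (k : ℝ) / n ≤ k := div_le_self (by positivity) (by linarith)
    gcongr
  have := (isKernel_unifKer (k := k) hn).prodProb_spread_le (n := n) (s₀ := 0) (δ := δ)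
    (by linarith) hδ hδ1
    (fun _ _ => by rw [unifKer, inv_eq_one_div]; gcongr; linarith)
    (fun _ S _ => by
      simp only [unifKer, Finset.sum_const, nsmul_eq_mul, ← div_eq_mul_inv]
      gcongr
      nlinarith [(Nat.cast_nonneg S.card : (0 : ℝ) ≤ _)]) {a} (by simp)
    (by simp; linarith) (by simpa using hk) (by simpa using hd)
  simpa [Concentrated] using this

/-- Some vertex holds at least `M` agents. -/
def Crowded (M : ℝ) (x : Fin k → Fin n) : Prop :=
  ∃ v, M ≤ (Finset.univ.filter fun a => x a = v).card

lemma trajProb_crowded_le (hn : 2 ≤ n) (hk : n ≤ k) (T : ℕ) {M : ℝ} (hM : 0 < M) :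
    trajProb n k (T + 1) (fun x _ => Crowded M x) ≤ 3 * (((k : ℝ) / n) ^ 2 * n / M ^ 2) := by
  have h2 : (2 : ℝ) ≤ n := by exact_mod_cast hn
  have hk' : (n : ℝ) ≤ k := by exact_mod_cast hk
  have hF : trajProb n k T (fun _ _ => False) = 0 := by
    simp [trajProb, trajExp, ind_of_not]
  refine (trajProb_succ_le hn (by omega) T (fun _ _ => False) _
    (ε := 3 * (((k : ℝ) / n) ^ 2 * n / M ^ 2)) (by positivity) ?_).trans (by rw [hF, zero_add])
  intro x G _
  have := (isKernel_stepKer hn x).prodProb_crowded_le (p := ((n : ℝ) - 1)⁻¹)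
    (inv_nonneg.mpr (by linarith)) (stepKer_le hn x) hM Finset.univ
  refine this.trans ?_
  rw [← mul_div_assoc]
  gcongr
  rw [Finset.card_univ, Fintype.card_fin]
  have e : ((n : ℝ) - 1)⁻¹ ≤ 2 / n := by
    rw [inv_eq_one_div, div_le_div_iff₀ (by linarith) (by linarith)]
    linarith
  have e2 : (k : ℝ) ≤ (k : ℝ) ^ 2 / n := by
    rw [le_div_iff₀ (by linarith)]
    nlinarith
  calc (k : ℝ) + k ^ 2 * ((n : ℝ) - 1)⁻¹ ≤ k ^ 2 / n + k ^ 2 * (2 / n) := by gcongr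
    _ = 3 * (((k : ℝ) / n) ^ 2 * n) := by field_simp; ring

lemma sum_stepKer_agents_ge (hn : 2 ≤ n) {M g : ℝ} (x : Fin k → Fin n)
    (hM : ¬ Crowded M x) (A : Finset (Fin k)) (hA : g + M ≤ A.card) (v : Fin n) :
    g / n ≤ ∑ a ∈ A, stepKer x a v := by
  have h2 : (2 : ℝ) ≤ n := by exact_mod_cast hn
  simp only [Crowded, not_exists, not_le] at hM
  have e : ∑ a ∈ A, stepKer x a v =
      ((A.filter fun a => ¬ v = x a).card : ℝ) * ((n : ℝ) - 1)⁻¹ := by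
    simp only [stepKer]
    rw [Finset.sum_ite, Finset.sum_const_zero, zero_add, Finset.sum_const, nsmul_eq_mul]
  have h1 : (A.card : ℝ) = (A.filter fun a => v = x a).card +
      (A.filter fun a => ¬ v = x a).card := by
    exact_mod_cast (Finset.card_filter_add_card_filter_not _).symm
  have h3 : ((A.filter fun a => v = x a).card : ℝ) ≤
      (Finset.univ.filter fun a => x a = v).card := by
    refine Nat.cast_le.mpr (Finset.card_le_card fun a ha => ?_)
    simp only [Finset.mem_filter, Finset.mem_univ, true_and] at ha ⊢
    exact ha.2.symm
  have h4 := hM v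
  rw [e, ← div_eq_mul_inv]
  have h5 : g ≤ (A.filter fun a => ¬ v = x a).card := by linarith
  calc g / n ≤ ((A.filter fun a => ¬ v = x a).card : ℝ) / n := by gcongr
    _ ≤ _ := by apply div_le_div_of_nonneg_left <;> first | positivity | linarith

/-- If many agents are green and no vertex is crowded then the next round completes the
broadcast. -/
lemma trajProb_ne_univ_le (hn : 2 ≤ n) (hk : 0 < k) (T : ℕ) {M g : ℝ} :
    trajProb n k (T + 1) (fun _ G => G ≠ Finset.univ) ≤
      trajProb n k T (fun _ G => ¬ g + M ≤ G.card) + trajProb n k T (fun x _ => Crowded M x) +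
        n * Real.exp (-(g / n)) := by
  refine (trajProb_succ_le hn hk T (fun x G => ¬ g + M ≤ G.card ∨ Crowded M x) _
    (ε := n * Real.exp (-(g / n))) (by positivity) ?_).trans
    (add_le_add_left (trajProb_or_le hn T _ _) _)
  intro x G h
  push Not at h
  exact (isKernel_stepKer hn x).prodProb_spread_ne_univ_le G
    (sum_stepKer_agents_ge hn x h.2 G h.1) (by simp)

/-- If few agents are green and no vertex is crowded then the next round does not complete the
broadcast. -/
lemma trajProb_eq_univ_le (hn : 3 ≤ n) (hk : 0 < k) (T : ℕ) {g : ℝ} (hgk : g ≤ k / 2) :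
    trajProb n k (T + 1) (fun _ G => G = Finset.univ) ≤
      trajProb n k T (fun _ G => ¬ G.card ≤ g) +
        trajProb n k T (fun x _ => Crowded ((k : ℝ) / 4) x) +
        (1 / Real.exp (Real.log n - g / (n - 2)) + Real.exp (-((k : ℝ) / 4 / n))) := by
  have hn2 : 2 ≤ n := by omega
  have h3 : (3 : ℝ) ≤ n := by exact_mod_cast hn
  refine (trajProb_succ_le hn2 hk T (fun x G => ¬ G.card ≤ g ∨ Crowded ((k : ℝ) / 4) x) _
    (ε := 1 / Real.exp (Real.log n - g / (n - 2)) + Real.exp (-((k : ℝ) / 4 / n)))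
    (by positivity) ?_).trans (add_le_add_left (trajProb_or_le hn2 T _ _) _)
  intro x G h
  push Not at h
  refine (isKernel_stepKer hn2 x).prodProb_spread_eq_univ_le G (Real.exp_pos _) ?_
    (sum_stepKer_agents_ge hn2 x h.2 Gᶜ ?_)
  · have h1 : Real.exp (-(1 / ((n : ℝ) - 2))) ≤ 1 - ((n : ℝ) - 1)⁻¹ := by
      rw [Real.exp_neg]
      have := Real.add_one_le_exp (1 / ((n : ℝ) - 2))
      have e : 1 - ((n : ℝ) - 1)⁻¹ = (1 / ((n : ℝ) - 2) + 1)⁻¹ := by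
        obtain ⟨u, hu⟩ : ∃ u : ℝ, (n : ℝ) = u + 2 := ⟨n - 2, by ring⟩
        have h0 : 0 < u := by linarith
        rw [hu, show u + 2 - 1 = u + 1 by ring, show u + 2 - 2 = u by ring]
        field_simp
        ring
      rw [e]
      have : 0 < 1 / ((n : ℝ) - 2) := by
        apply div_pos <;> linarith
      gcongr
    have h2 : ∀ v ∈ (Finset.univ : Finset (Fin n)),
        Real.exp (-(g / (n - 2))) ≤ ∏ a ∈ G, (1 - stepKer x a v) := by
      intro v _
      calc Real.exp (-(g / (n - 2))) ≤ Real.exp (G.card * -(1 / ((n : ℝ) - 2))) := by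
            apply Real.exp_le_exp.mpr
            have : (G.card : ℝ) / ((n : ℝ) - 2) ≤ g / (n - 2) :=
              div_le_div_of_nonneg_right h.1 (by linarith)
            rw [mul_neg, mul_one_div]
            linarith
        _ = ∏ a ∈ G, Real.exp (-(1 / ((n : ℝ) - 2))) := by
            rw [Finset.prod_const, ← Real.exp_nat_mul]
        _ ≤ _ := Finset.prod_le_prod (fun _ _ => (Real.exp_pos _).le) fun a _ => by
            have := stepKer_le hn2 x a v
            linarith
    have := Finset.card_nsmul_le_sum _ _ _ h2
    rw [nsmul_eq_mul, Finset.card_univ, Fintype.card_fin] at this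
    rwa [sub_eq_add_neg, Real.exp_add, Real.exp_log (by linarith)]
  · rw [Finset.card_compl, Fintype.card_fin, Nat.cast_sub (by simpa using Finset.card_le_univ G)]
    linarith [h.1]

end Rounds

section Asymptotics

open Topology

lemma tendsto_zero_of_log_div {u : ℕ → ℝ} {c : ℝ} (hc : c < 0) (hu : ∀ᶠ n in atTop, 0 < u n)
    (h : Tendsto (fun n : ℕ => Real.log (u n) / Real.log n) atTop (𝓝 c)) :
    Tendsto u atTop (𝓝 0) := by
  have hL : Tendsto (fun n : ℕ => Real.log n) atTop atTop :=
    Real.tendsto_log_atTop.comp tendsto_natCast_atTop_atTop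
  have h1 := Real.tendsto_exp_atBot.comp (h.neg_mul_atTop hc hL)
  refine h1.congr' ?_
  filter_upwards [hu, hL.eventually_gt_atTop 0] with n hn hl
  simp only [Function.comp]
  rw [div_mul_cancel₀ _ hl.ne', Real.exp_log hn]

/-- The average number of agents per vertex. -/
noncomputable def dens (k : ℕ → ℕ) (n : ℕ) : ℝ := (k n : ℝ) / n

/-- The consequences of `k = n ^ (1 + 1 / (j + 1) + o(1))` that drive the process. -/
structure CriticalDensity (k : ℕ → ℕ) (j : ℕ) : Prop where
  tendsto_dens : Tendsto (dens k) atTop atTop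
  pow_div : Tendsto (fun n => dens k n ^ j / n) atTop (𝓝 0)
  log_div_sqrt : Tendsto (fun n : ℕ => Real.log n / √(dens k n)) atTop (𝓝 0)
  div_pow : Tendsto (fun n : ℕ => n / (dens k n ^ (j + 1) * √(dens k n))) atTop (𝓝 0)

lemma criticalDensity {k : ℕ → ℕ} {j : ℕ}
    (hk : Tendsto (fun n => Real.log (k n) / Real.log n) atTop (𝓝 (1 + 1 / ((j + 1 : ℕ) : ℝ)))) :
    CriticalDensity k j := by
  set c : ℝ := 1 / ((j + 1 : ℕ) : ℝ) with hc
  have hc0 : 0 < c := by positivity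
  have hcj : (j : ℝ) * c = 1 - c := by
    rw [hc]; push_cast; field_simp; ring
  have hL : Tendsto (fun n : ℕ => Real.log n) atTop atTop :=
    Real.tendsto_log_atTop.comp tendsto_natCast_atTop_atTop
  have hL0 := hL.eventually_gt_atTop 0
  have hn0 : ∀ᶠ n : ℕ in atTop, (0 : ℝ) < n := by
    filter_upwards [eventually_gt_atTop 0] with n hn
    exact_mod_cast hn
  have hk0 : ∀ᶠ n in atTop, (0 : ℝ) < k n := by
    filter_upwards [hk.eventually_const_lt (u := 0) (by linarith)] with n hn
    by_contra h
    have : (k n : ℝ) = 0 := le_antisymm (not_lt.mp h) (Nat.cast_nonneg _)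
    simp [this] at hn
  have hd0 : ∀ᶠ n in atTop, 0 < dens k n := by
    filter_upwards [hn0, hk0] with n h1 h2
    exact div_pos h2 h1
  have hd : Tendsto (fun n : ℕ => Real.log (dens k n) / Real.log n) atTop (𝓝 c) := by
    have : Tendsto (fun n => Real.log (k n) / Real.log n - 1) atTop (𝓝 (1 + c - 1)) :=
      hk.sub_const 1
    rw [add_sub_cancel_left] at this
    refine this.congr' ?_
    filter_upwards [hn0, hk0, hL0] with n h1 h2 h3
    rw [dens, Real.log_div h2.ne' h1.ne', sub_div, div_self h3.ne']
  have hone : Tendsto (fun n : ℕ => Real.log n / Real.log n) atTop (𝓝 1) := by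
    refine tendsto_const_nhds.congr' ?_
    filter_upwards [hL0] with n h
    rw [div_self h.ne']
  have hloglog : Tendsto (fun n : ℕ => Real.log (Real.log n) / Real.log n) atTop (𝓝 0) :=
    (Real.isLittleO_log_id_atTop.tendsto_div_nhds_zero).comp hL
  refine ⟨?_, ?_, ?_, ?_⟩
  · have : Tendsto (fun n => Real.log (dens k n) / Real.log n * Real.log n) atTop atTop :=
      hd.pos_mul_atTop hc0 hL
    refine (Real.tendsto_exp_atTop.comp this).congr' ?_
    filter_upwards [hd0, hL0] with n h1 h2
    simp only [Function.comp]
    rw [div_mul_cancel₀ _ h2.ne', Real.exp_log h1]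
  · refine tendsto_zero_of_log_div (c := j * c - 1) (by linarith) ?_ ?_
    · filter_upwards [hn0, hd0] with n h1 h2
      positivity
    · refine ((hd.const_mul (j : ℝ)).sub hone).congr' ?_
      filter_upwards [hn0, hd0] with n h1 h2
      rw [Real.log_div (by positivity) h1.ne', Real.log_pow]
      ring
  · refine tendsto_zero_of_log_div (c := 0 - c / 2) (by linarith) ?_ ?_
    · filter_upwards [hL0, hd0] with n h1 h2
      positivity
    · refine (hloglog.sub (hd.div_const 2)).congr' ?_
      filter_upwards [hL0, hd0] with n h1 h2
      rw [Real.log_div h1.ne' (by positivity), Real.log_sqrt h2.le]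
      ring
  · refine tendsto_zero_of_log_div (c := 1 - ((j + 1 : ℕ) * c + c / 2)) ?_ ?_ ?_
    · push_cast; linarith
    · filter_upwards [hn0, hd0] with n h1 h2
      positivity
    · refine (hone.sub ((hd.const_mul ((j + 1 : ℕ) : ℝ)).add (hd.div_const 2))).congr' ?_
      filter_upwards [hn0, hd0] with n h1 h2
      rw [Real.log_div h1.ne' (by positivity), Real.log_mul (by positivity) (by positivity),
        Real.log_pow, Real.log_sqrt h2.le]
      ring

namespace CriticalDensity

variable {k : ℕ → ℕ} {j : ℕ} (hk : CriticalDensity k j)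

include hk

lemma eventually_le : ∀ᶠ n in atTop, n ≤ k n := by
  filter_upwards [hk.tendsto_dens.eventually_ge_atTop 1, eventually_gt_atTop 0] with n h hn
  have : (0 : ℝ) < n := by exact_mod_cast hn
  rw [dens, le_div_iff₀ this, one_mul] at h
  exact_mod_cast h

lemma tendsto_concentrated {δ : ℝ} (hδ : 0 < δ) (hδ1 : δ < 1) {t : ℕ} (ht : t ≤ j) :
    Tendsto (fun n => trajProb n (k n) t fun _ G => ¬ Concentrated δ (dens k n) (t + 1) G)
      atTop (𝓝 0) := by
  have h1δ : 0 < 1 - δ := by linarith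
  have hinv : Tendsto (fun n => (dens k n)⁻¹) atTop (𝓝 0) :=
    tendsto_inv_atTop_zero.comp hk.tendsto_dens
  have hninv : Tendsto (fun n : ℕ => ((n : ℝ))⁻¹) atTop (𝓝 0) :=
    tendsto_inv_atTop_zero.comp tendsto_natCast_atTop_atTop
  have hnδ : ∀ᶠ n : ℕ in atTop, 2 / δ ≤ n :=
    tendsto_natCast_atTop_atTop.eventually_ge_atTop _
  have hdδ : ∀ᶠ n in atTop, 1 ≤ δ * dens k n := by
    filter_upwards [hk.tendsto_dens.eventually_ge_atTop (1 / δ)] with n h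
    rwa [div_le_iff₀' hδ] at h
  induction t with
  | zero =>
    have hlim : Tendsto (fun n : ℕ => 2 / δ * (n : ℝ)⁻¹ +
        1 / (δ ^ 2 * (1 - δ) ^ 3) * (dens k n)⁻¹) atTop (𝓝 0) := by
      simpa only [mul_zero, add_zero] using (hninv.const_mul (2 / δ)).add (hinv.const_mul (1 / (δ ^ 2 * (1 - δ) ^ 3)))
    refine squeeze_zero' ?_ ?_ hlim
    · filter_upwards [eventually_ge_atTop 2] with n hn
      exact trajProb_nonneg hn _ _
    · filter_upwards [eventually_ge_atTop 2, hdδ, hk.eventually_le] with n hn hd hnk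
      rw [trajProb_zero (by omega)]
      refine (prodProb_spread_unifKer_le hn hδ hδ1 _ hd).trans_eq ?_
      rw [← dens]
      have : 0 < dens k n := pos_of_mul_pos_right (lt_of_lt_of_le one_pos hd) hδ.le
      have : (0 : ℝ) < n := by positivity
      field_simp
  | succ t ih =>
    set c := (1 - δ) ^ (4 * (t + 1)) with hc
    set C := (1 + δ) ^ (4 * (t + 1)) with hC
    have hc0 : 0 < c := by positivity
    have hC0 : 0 < C := by positivity
    have hlim : Tendsto (fun n : ℕ =>
        trajProb n (k n) t (fun _ G => ¬ Concentrated δ (dens k n) (t + 1) G) +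
        (2 * C / δ * (dens k n ^ j / n) +
          1 / (δ ^ 2 * (1 - δ) ^ 3 * c) * (dens k n)⁻¹)) atTop (𝓝 0) := by
      simpa only [mul_zero, add_zero] using (ih (by omega)).add ((hk.pow_div.const_mul (2 * C / δ)).add
        (hinv.const_mul (1 / (δ ^ 2 * (1 - δ) ^ 3 * c))))
    have hbig : ∀ᶠ n in atTop, 1 / δ ≤ (1 - δ) * (c * dens k n) := by
      filter_upwards [hk.tendsto_dens.eventually_ge_atTop (1 / δ / ((1 - δ) * c))] with n h
      rw [div_le_iff₀ (by positivity)] at h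
      linarith
    have hsmall : ∀ᶠ n : ℕ in atTop, dens k n ^ j / n < δ / C :=
      hk.pow_div.eventually_lt_const (by positivity)
    refine squeeze_zero' ?_ ?_ hlim
    · filter_upwards [eventually_ge_atTop 2] with n hn
      exact trajProb_nonneg hn _ _
    filter_upwards [eventually_ge_atTop 2, hdδ, hk.eventually_le, hnδ, hbig, hsmall,
      hk.tendsto_dens.eventually_ge_atTop 1] with n hn hd hnk hnδ hbig hsmall hd1
    have h2 : (2 : ℝ) ≤ n := by exact_mod_cast hn
    have hn0 : (0 : ℝ) < n := by linarith
    have hd0 : 0 < dens k n := by linarith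
    refine trajProb_succ_le hn (by omega) t _ _ (by positivity) fun x G hG => ?_
    rw [not_not] at hG
    obtain ⟨hGl, hGu⟩ := hG
    rw [← hc] at hGl
    rw [← hC] at hGu
    have hGl' : c * dens k n ≤ G.card :=
      (mul_le_mul_of_nonneg_left (le_self_pow₀ hd1 (by omega)) hc0.le).trans hGl
    have hGu' : (G.card : ℝ) ≤ C * dens k n ^ j :=
      hGu.trans (by gcongr)
    have hGk : (G.card : ℝ) ≤ δ * k n := by
      rw [div_lt_div_iff₀ hn0 hC0] at hsmall
      have : (n : ℝ) ≤ k n := by exact_mod_cast hnk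
      nlinarith
    have key := prodProb_spread_stepKer_le hn hδ hδ1 hnδ x G
      (hbig.trans (by gcongr)) hGk hd
    rw [← dens] at key
    refine ((isKernel_stepKer hn x).prodProb_mono fun y => ?_).trans (key.trans ?_)
    · contrapose!
      rintro ⟨hl, hu⟩
      constructor
      · refine le_trans ?_ hl
        calc (1 - δ) ^ (4 * (t + 1 + 1)) * dens k n ^ (t + 1 + 1)
            = (1 - δ) ^ 4 * dens k n * (c * dens k n ^ (t + 1)) := by rw [hc]; ring
          _ ≤ _ := by gcongr
      · refine hu.trans ?_
        calc _ ≤ (1 + δ) ^ 4 * dens k n * (C * dens k n ^ (t + 1)) := by gcongr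
          _ = _ := by rw [hC]; ring
    · gcongr ?_ + ?_
      · calc 2 * (G.card : ℝ) / (δ * n) ≤ 2 * (C * dens k n ^ j) / (δ * n) := by gcongr
          _ = _ := by ring
      · calc 1 / (δ ^ 2 * ((1 - δ) ^ 3 * dens k n * G.card))
            ≤ 1 / (δ ^ 2 * ((1 - δ) ^ 3 * dens k n * c)) := by
              gcongr
              exact le_trans (by nlinarith) hGl'
          _ = _ := by field_simp

lemma tendsto_crowded (t : ℕ) {M : ℕ → ℝ} (hM : ∀ᶠ n in atTop, 0 < M n)
    (h : Tendsto (fun n => dens k n ^ 2 * n / M n ^ 2) atTop (𝓝 0)) :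
    Tendsto (fun n => trajProb n (k n) (t + 1) fun x _ => Crowded (M n) x) atTop (𝓝 0) := by
  refine squeeze_zero' ?_ ?_ (by simpa using h.const_mul 3)
  · filter_upwards [eventually_ge_atTop 2] with n hn
    exact trajProb_nonneg hn _ _
  · filter_upwards [eventually_ge_atTop 2, hk.eventually_le, hM] with n hn hnk hM
    exact trajProb_crowded_le hn hnk t hM

/-- One more round completes the broadcast. -/
lemma tendsto_probXiLe_one (t : ℕ) {M g : ℕ → ℝ} (hM : ∀ᶠ n in atTop, 0 < M n)
    (h : Tendsto (fun n => dens k n ^ 2 * n / M n ^ 2) atTop (𝓝 0))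
    (hG : Tendsto (fun n => trajProb n (k n) (t + 1) fun _ G => ¬ g n + M n ≤ G.card)
      atTop (𝓝 0))
    (hg : Tendsto (fun n : ℕ => n * Real.exp (-(g n / n))) atTop (𝓝 0)) :
    Tendsto (fun n => probXiLe n (k n) (t + 2)) atTop (𝓝 1) := by
  have h1 : Tendsto (fun n => trajProb n (k n) (t + 2) fun _ G => ¬ G = Finset.univ)
      atTop (𝓝 0) := by
    refine squeeze_zero' ?_ ?_
      (by simpa only [add_zero] using (hG.add (hk.tendsto_crowded t hM h)).add hg)
    · filter_upwards [eventually_ge_atTop 2] with n hn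
      exact trajProb_nonneg hn _ _
    · filter_upwards [eventually_ge_atTop 2, hk.eventually_le] with n hn hnk
      have hk0 : 0 < k n := by omega
      exact trajProb_ne_univ_le hn hk0 (t + 1)
  have h2 := h1.const_sub 1
  rw [sub_zero] at h2
  refine h2.congr' ?_
  filter_upwards [eventually_ge_atTop 2, hk.eventually_le] with n hn hnk
  have hk0 : 0 < k n := by omega
  rw [trajProb_not hn hk0, probXiLe_eq_trajProb]
  ring

lemma tendsto_probXiLe_before :
    Tendsto (fun n => probXiLe n (k n) j) atTop (𝓝 0) := by
  have hsmall : ∀ᶠ n : ℕ in atTop, dens k n ^ j / n < 1 / (1 + (1 / 2 : ℝ)) ^ (4 * (j + 1)) :=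
    hk.pow_div.eventually_lt_const (by positivity)
  refine squeeze_zero' ?_ ?_
    (hk.tendsto_concentrated (δ := 1 / 2) (by norm_num) (by norm_num) le_rfl)
  · filter_upwards [eventually_ge_atTop 2] with n hn
    rw [probXiLe_eq_trajProb]
    exact trajProb_nonneg hn _ _
  · filter_upwards [eventually_ge_atTop 2, hk.eventually_le, hsmall,
      hk.tendsto_dens.eventually_ge_atTop 1] with n hn hnk hs hd1
    rw [probXiLe_eq_trajProb]
    refine trajProb_mono hn ?_
    rintro x G rfl ⟨-, hu⟩
    have hn0 : (0 : ℝ) < n := by positivity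
    rw [div_lt_div_iff₀ hn0 (by positivity)] at hs
    rw [Finset.card_univ, Fintype.card_fin] at hu
    have hkd : (k n : ℝ) = dens k n * n := by rw [dens, div_mul_cancel₀ _ hn0.ne']
    have : (k n : ℝ) < k n := by
      calc (k n : ℝ) ≤ dens k n * (dens k n ^ j * (1 + (1 / 2 : ℝ)) ^ (4 * (j + 1))) := by
            refine hu.trans_eq ?_
            ring
        _ < dens k n * (1 * n) := by gcongr
        _ = k n := by rw [hkd]; ring
    exact lt_irrefl _ this

lemma tendsto_dens_div (hj : 1 ≤ j) : Tendsto (fun n => dens k n / n) atTop (𝓝 0) := by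
  refine squeeze_zero' ?_ ?_ hk.pow_div
  · exact Eventually.of_forall fun n => by unfold dens; positivity
  · filter_upwards [hk.tendsto_dens.eventually_ge_atTop 1] with n hd
    gcongr
    exact le_self_pow₀ hd (by omega)

/-- After round `j + 1` much more than `n * log n` agents are green. -/
lemma tendsto_many_green (hj : 1 ≤ j) :
    Tendsto (fun n => trajProb n (k n) (j + 1) fun _ G => ¬ n * √(dens k n) / 32 ≤ G.card)
      atTop (𝓝 0) := by
  have hsqrt : Tendsto (fun n => (√(dens k n))⁻¹) atTop (𝓝 0) :=
    tendsto_inv_atTop_zero.comp (Real.tendsto_sqrt_atTop.comp hk.tendsto_dens)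
  have hlim : Tendsto (fun n =>
      trajProb n (k n) j (fun _ G => ¬ Concentrated (1 / 2) (dens k n) (j + 1) G) +
        12 * (√(dens k n))⁻¹) atTop (𝓝 0) := by
    simpa only [mul_zero, add_zero] using
      (hk.tendsto_concentrated (δ := 1 / 2) (by norm_num) (by norm_num) le_rfl).add
        (hsqrt.const_mul 12)
  set c : ℝ := (1 - 1 / 2) ^ (4 * (j + 1)) with hc
  have hc0 : 0 < c := by rw [hc]; norm_num
  refine squeeze_zero' ?_ ?_ hlim
  · filter_upwards [eventually_ge_atTop 2] with n hn
    exact trajProb_nonneg hn _ _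
  filter_upwards [eventually_ge_atTop 4, hk.eventually_le,
    hk.tendsto_dens.eventually_ge_atTop 4, hk.div_pow.eventually_lt_const hc0,
    (hk.tendsto_dens_div hj).eventually_lt_const (u := 1 / 8) (by norm_num)]
    with n hn hnk hd hdp hdn
  have hn4 : (4 : ℝ) ≤ n := by exact_mod_cast hn
  have hnk' : (n : ℝ) ≤ k n := by exact_mod_cast hnk
  have hn0 : (0 : ℝ) < n := by linarith
  set d := dens k n with hdd
  set s := √d with hs
  have hsd : s ^ 2 = d := Real.sq_sqrt (by linarith)
  have hs2 : 2 ≤ s := Real.le_sqrt_of_sq_le (by linarith)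
  have hs0 : 0 < s := by linarith
  have hnd : 8 ≤ n / s := by
    rw [div_lt_iff₀ hn0] at hdn
    rw [le_div_iff₀ hs0]
    nlinarith
  have hm1 := Nat.floor_le (show 0 ≤ n / s by positivity)
  have hm2 := Nat.lt_floor_add_one (n / s)
  set m := ⌊n / s⌋₊
  have hm4 : (4 : ℝ) ≤ m := by linarith
  have hmn : n / (2 * s) ≤ m := by
    have : n / (2 * s) = n / s / 2 := by field_simp
    linarith
  refine trajProb_succ_le (by omega) (by omega) j _ _ (by positivity) fun x G hG => ?_
  rw [not_not] at hG
  have hmG : m ≤ G.card := by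
    have h1 : (m : ℝ) ≤ G.card := by
      refine hm1.trans (le_trans ?_ hG.1)
      rw [div_lt_iff₀ (by positivity)] at hdp
      rw [div_le_iff₀ hs0, ← hc]
      linarith
    exact_mod_cast h1
  obtain ⟨A, hAG, hAm⟩ := Finset.exists_subset_card_eq hmG
  have hAm' : (A.card : ℝ) = m := by rw [hAm]
  have hmle : (m : ℝ) ≤ n / 2 := by
    refine hm1.trans ?_
    gcongr
  have hnn : 2 ≤ n := by omega
  have key := prodProb_spread_stepKer_le hnn (δ := 1 / 2) (by norm_num) (by norm_num)
    (by linarith) x A (by linarith) (by linarith) (by rw [← dens, ← hdd]; linarith)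
  rw [← dens, ← hdd, hAm'] at key
  refine ((isKernel_stepKer hnn x).prodProb_mono fun y => ?_).trans (key.trans ?_)
  · contrapose!
    rintro ⟨hl, -⟩
    have hsp : ((spread A y).card : ℝ) ≤ (spread G y).card :=
      Nat.cast_le.mpr (Finset.card_le_card (spread_mono hAG y))
    refine le_trans ?_ (hl.trans hsp)
    rw [div_le_iff₀ (by positivity)] at hmn
    rw [← hsd]
    nlinarith
  · have h1 : 2 * (m : ℝ) / (1 / 2 * n) ≤ 4 * s⁻¹ := by
      calc 2 * (m : ℝ) / (1 / 2 * n) ≤ 2 * (n / s) / (1 / 2 * n) := by gcongr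
        _ = 4 * s⁻¹ := by field_simp; norm_num
    have h2 : 1 / ((1 / 2 : ℝ) ^ 2 * ((1 - 1 / 2) ^ 3 * d * m)) ≤ 8 * s⁻¹ := by
      rw [← div_eq_mul_inv, div_le_div_iff₀ (by norm_num; positivity) hs0, ← hsd]
      nlinarith [mul_nonneg (sq_nonneg s) (sub_nonneg.mpr hm4)]
    linarith

omit hk in
lemma tendsto_mul_exp_neg {η : ℝ} (hη : 0 < η) {g : ℕ → ℝ}
    (h : ∀ᶠ n : ℕ in atTop, (1 + η) * Real.log n ≤ g n / n) :
    Tendsto (fun n : ℕ => n * Real.exp (-(g n / n))) atTop (𝓝 0) := by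
  have hL : Tendsto (fun n : ℕ => Real.exp (-(η * Real.log n))) atTop (𝓝 0) :=
    Real.tendsto_exp_neg_atTop_nhds_zero.comp
      ((Real.tendsto_log_atTop.comp tendsto_natCast_atTop_atTop).const_mul_atTop hη)
  refine squeeze_zero' (Eventually.of_forall fun n => by positivity) ?_ hL
  filter_upwards [h, eventually_gt_atTop 0] with n hn hn0
  have : (0 : ℝ) < n := by exact_mod_cast hn0
  calc (n : ℝ) * Real.exp (-(g n / n)) = Real.exp (Real.log n + -(g n / n)) := by
        rw [Real.exp_add, Real.exp_log this]
    _ ≤ _ := Real.exp_le_exp.mpr (by linarith)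

lemma tendsto_probXiLe_after (hj : 1 ≤ j) :
    Tendsto (fun n => probXiLe n (k n) (j + 2)) atTop (𝓝 1) := by
  have hd1 := hk.tendsto_dens.eventually_ge_atTop 1
  refine hk.tendsto_probXiLe_one j (M := fun n => n * √(dens k n) / 64)
    (g := fun n => n * √(dens k n) / 64) ?_ ?_ ?_ (tendsto_mul_exp_neg one_pos ?_)
  · filter_upwards [hd1, eventually_gt_atTop 0] with n h hn
    have : (0 : ℝ) < n := by exact_mod_cast hn
    positivity
  · have := (hk.tendsto_dens_div hj).const_mul 4096
    rw [mul_zero] at this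
    refine this.congr' ?_
    filter_upwards [hd1, eventually_gt_atTop 0] with n h hn
    have : (0 : ℝ) < n := by exact_mod_cast hn
    rw [_root_.div_pow, mul_pow, Real.sq_sqrt (by linarith)]
    have : 0 < dens k n := by linarith
    field_simp
    norm_num
  · refine (hk.tendsto_many_green hj).congr fun n => ?_
    congr 1
    funext x G
    congr 2
    ring
  · filter_upwards [hk.log_div_sqrt.eventually_lt_const (u := 1 / 128) (by norm_num), hd1,
      eventually_gt_atTop 0] with n h hd hn
    have : (0 : ℝ) < n := by exact_mod_cast hn
    rw [div_lt_iff₀ (by positivity)] at h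
    rw [show n * √(dens k n) / 64 / n = √(dens k n) / 64 by field_simp]
    linarith

lemma tendsto_probXiLe_of_gt (hj : 1 ≤ j) {ε : ℝ} (hε : 0 < ε)
    (h : ∀ᶠ n : ℕ in atTop, dens k n ^ (j + 1) > (1 + ε) * n * Real.log n) :
    Tendsto (fun n => probXiLe n (k n) (j + 1)) atTop (𝓝 1) := by
  have hd1 := hk.tendsto_dens.eventually_ge_atTop 1
  have hL : Tendsto (fun n : ℕ => Real.log n) atTop atTop :=
    Real.tendsto_log_atTop.comp tendsto_natCast_atTop_atTop
  obtain ⟨θ, hθ0, hθ1, hθε⟩ : ∃ θ : ℝ, 0 < θ ∧ θ < 1 ∧ 1 + ε / 2 ≤ (1 - 2 * θ) * (1 + ε) := by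
    refine ⟨ε / (8 * (1 + ε)), by positivity, ?_, ?_⟩
    · rw [div_lt_one (by positivity)]; linarith
    · have : (1 - 2 * (ε / (8 * (1 + ε)))) * (1 + ε) = 1 + ε - ε / 4 := by field_simp; ring
      linarith
  have hθ2 : 0 < 1 - 2 * θ := pos_of_mul_pos_left (lt_of_lt_of_le (by positivity) hθε) (by positivity)
  set δ := θ / (4 * (j + 1 : ℕ)) with hδ
  have hδ0 : 0 < δ := by positivity
  have hδθ : ((4 * (j + 1) : ℕ) : ℝ) * δ = θ := by rw [hδ]; push_cast; field_simp
  have hδ1 : δ < 1 := by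
    refine lt_of_le_of_lt (div_le_self hθ0.le ?_) hθ1
    push_cast
    linarith [(Nat.cast_nonneg j : (0 : ℝ) ≤ j)]
  have hbern : 1 - θ ≤ (1 - δ) ^ (4 * (j + 1)) := by
    have := one_add_mul_le_pow (a := -δ) (by linarith) (4 * (j + 1))
    rw [← sub_eq_add_neg] at this
    linarith
  have hfin := hk.tendsto_probXiLe_one (j - 1) (M := fun n => θ * dens k n ^ (j + 1))
    (g := fun n => (1 - 2 * θ) * dens k n ^ (j + 1)) ?_ ?_ ?_
    (tendsto_mul_exp_neg (half_pos hε) ?_)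
  · rwa [show j - 1 + 2 = j + 1 by omega] at hfin
  · filter_upwards [hd1] with n hd
    positivity
  · have hlim : Tendsto (fun n : ℕ => 1 / θ ^ 2 * (Real.log n)⁻¹) atTop (𝓝 0) := by
      simpa only [mul_zero, Function.comp_def] using
        (tendsto_inv_atTop_zero.comp hL).const_mul (1 / θ ^ 2)
    refine squeeze_zero' (Eventually.of_forall fun n => by positivity) ?_ hlim
    filter_upwards [h, hd1, eventually_gt_atTop 0, hL.eventually_gt_atTop 0] with n h hd hn hl
    have hn0 : (0 : ℝ) < n := by exact_mod_cast hn
    have hd0 : 0 < dens k n := by linarith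
    have h1 : n * Real.log n ≤ dens k n ^ (j + 1) := by
      have : 0 < n * Real.log n := by positivity
      nlinarith
    have h2 : dens k n ^ (j + 1) * dens k n ^ 2 ≤ (dens k n ^ (j + 1)) ^ 2 := by
      rw [← pow_add, ← pow_mul]
      exact pow_le_pow_right₀ hd (by omega)
    calc dens k n ^ 2 * n / (θ * dens k n ^ (j + 1)) ^ 2
        = 1 / θ ^ 2 * (dens k n ^ 2 * n / (dens k n ^ (j + 1)) ^ 2) := by
          field_simp
      _ ≤ 1 / θ ^ 2 * (Real.log n)⁻¹ := by
          gcongr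
          rw [inv_eq_one_div, div_le_div_iff₀ (by positivity) hl, one_mul]
          calc dens k n ^ 2 * n * Real.log n = (n * Real.log n) * dens k n ^ 2 := by ring
            _ ≤ dens k n ^ (j + 1) * dens k n ^ 2 := by gcongr
            _ ≤ _ := h2
  · rw [Nat.sub_add_cancel hj]
    refine squeeze_zero' ?_ ?_ (hk.tendsto_concentrated hδ0 hδ1 le_rfl)
    · filter_upwards [eventually_ge_atTop 2] with n hn
      exact trajProb_nonneg hn _ _
    · filter_upwards [eventually_ge_atTop 2, hd1] with n hn hd
      refine trajProb_mono hn fun x G => ?_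
      contrapose!
      rintro ⟨hl, -⟩
      refine le_trans ?_ hl
      have : 0 ≤ dens k n ^ (j + 1) := by positivity
      nlinarith
  · filter_upwards [h, eventually_gt_atTop 0, hL.eventually_gt_atTop 0] with n h hn hl
    have hn0 : (0 : ℝ) < n := by exact_mod_cast hn
    rw [le_div_iff₀ hn0]
    calc (1 + ε / 2) * Real.log n * n ≤ ((1 - 2 * θ) * (1 + ε)) * Real.log n * n := by gcongr
      _ = (1 - 2 * θ) * ((1 + ε) * n * Real.log n) := by ring
      _ ≤ _ := by gcongr

lemma tendsto_probXiLe_of_lt (hj : 1 ≤ j) {ε : ℝ} (hε : 0 < ε)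
    (h : ∀ᶠ n : ℕ in atTop, dens k n ^ (j + 1) < (1 - ε) * n * Real.log n) :
    Tendsto (fun n => probXiLe n (k n) (j + 1)) atTop (𝓝 0) := by
  have hd1 := hk.tendsto_dens.eventually_ge_atTop 1
  have hL : Tendsto (fun n : ℕ => Real.log n) atTop atTop :=
    Real.tendsto_log_atTop.comp tendsto_natCast_atTop_atTop
  obtain ⟨δ, hδ0, hδ1, hδε⟩ : ∃ δ : ℝ, 0 < δ ∧ δ < 1 ∧
      (1 + δ) ^ (4 * (j + 1)) * (1 - ε) ≤ 1 - ε / 2 := by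
    have hc : Tendsto (fun δ : ℝ => (1 + δ) ^ (4 * (j + 1)) * (1 - ε)) (𝓝[>] 0)
        (𝓝 ((1 + 0) ^ (4 * (j + 1)) * (1 - ε))) :=
      (Continuous.tendsto (by fun_prop) 0).mono_left nhdsWithin_le_nhds
    rw [add_zero, one_pow, one_mul] at hc
    have h1 := hc.eventually_lt_const (u := 1 - ε / 2) (by linarith)
    have h2 : ∀ᶠ δ : ℝ in 𝓝[>] 0, δ < 1 :=
      nhdsWithin_le_nhds (eventually_lt_nhds one_pos)
    obtain ⟨δ, h1, h2, h3⟩ := (h1.and (h2.and self_mem_nhdsWithin)).exists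
    exact ⟨δ, h3, h2, h1.le⟩
  set C := (1 + δ) ^ (4 * (j + 1)) with hC
  have hC0 : 0 < C := by positivity
  have hratio : ∀ᶠ n : ℕ in atTop, (1 - ε / 2) * (n / ((n : ℝ) - 2)) ≤ 1 - ε / 4 := by
    have h1 : Tendsto (fun n : ℕ => (2 : ℝ) / ((n : ℝ) - 2)) atTop (𝓝 0) :=
      tendsto_const_nhds.div_atTop
        (tendsto_atTop_add_const_right _ (-2) tendsto_natCast_atTop_atTop)
    have h2 := (h1.const_add 1).const_mul (1 - ε / 2)
    rw [add_zero, mul_one] at h2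
    filter_upwards [h2.eventually_lt_const (u := 1 - ε / 4) (by linarith),
      eventually_ge_atTop 3] with n hn hn3
    have : (3 : ℝ) ≤ n := by exact_mod_cast hn3
    have e : (n : ℝ) / (n - 2) = 1 + 2 / (n - 2) := by
      have : (n : ℝ) - 2 ≠ 0 := by linarith
      field_simp
      ring
    rw [e]
    exact hn.le
  have hlim : Tendsto (fun n : ℕ =>
      trajProb n (k n) j (fun _ G => ¬ Concentrated δ (dens k n) (j + 1) G) +
        trajProb n (k n) (j - 1 + 1) (fun x _ => Crowded ((k n : ℝ) / 4) x) +
        (Real.exp (-(ε / 4 * Real.log n)) + Real.exp (-(1 / 4 * dens k n)))) atTop (𝓝 0) := by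
    have h1 := hk.tendsto_concentrated hδ0 hδ1 le_rfl
    have h2 := hk.tendsto_crowded (j - 1) (M := fun n => (k n : ℝ) / 4) ?_ ?_
    · have h3 : Tendsto (fun n : ℕ => Real.exp (-(ε / 4 * Real.log n))) atTop (𝓝 0) :=
        Real.tendsto_exp_neg_atTop_nhds_zero.comp (hL.const_mul_atTop (by positivity))
      have h4 : Tendsto (fun n : ℕ => Real.exp (-(1 / 4 * dens k n))) atTop (𝓝 0) :=
        Real.tendsto_exp_neg_atTop_nhds_zero.comp
          (hk.tendsto_dens.const_mul_atTop (by positivity))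
      simpa only [add_zero] using (h1.add h2).add (h3.add h4)
    · filter_upwards [hk.eventually_le, eventually_gt_atTop 0] with n hn hn0
      have : (0 : ℝ) < k n := by exact_mod_cast lt_of_lt_of_le hn0 hn
      positivity
    · have hninv : Tendsto (fun n : ℕ => 16 * ((n : ℝ))⁻¹) atTop (𝓝 0) := by
        simpa only [mul_zero, Function.comp_def] using
          (tendsto_inv_atTop_zero.comp tendsto_natCast_atTop_atTop).const_mul (16 : ℝ)
      refine hninv.congr' ?_
      filter_upwards [hk.eventually_le, eventually_gt_atTop 0] with n hn hn0
      have : (0 : ℝ) < k n := by exact_mod_cast lt_of_lt_of_le hn0 hn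
      have : (0 : ℝ) < n := by exact_mod_cast hn0
      rw [dens]
      field_simp
      norm_num
  rw [Nat.sub_add_cancel hj] at hlim
  have hsmall : ∀ᶠ n : ℕ in atTop, dens k n ^ j / n < 1 / (2 * C) :=
    hk.pow_div.eventually_lt_const (by positivity)
  refine squeeze_zero' ?_ ?_ hlim
  · filter_upwards [eventually_ge_atTop 2] with n hn
    rw [probXiLe_eq_trajProb]
    exact trajProb_nonneg hn _ _
  filter_upwards [eventually_ge_atTop 3, hk.eventually_le, hd1, hsmall, hratio, h,
    hL.eventually_gt_atTop 0] with n hn hnk hd hs hr h hl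
  have hn3 : (3 : ℝ) ≤ n := by exact_mod_cast hn
  have hn0 : (0 : ℝ) < n := by linarith
  have hd0 : 0 < dens k n := by linarith
  have hkd : (k n : ℝ) = dens k n * n := by rw [dens, div_mul_cancel₀ _ hn0.ne']
  have hk0 : 0 < k n := by omega
  rw [probXiLe_eq_trajProb]
  refine (trajProb_eq_univ_le hn hk0 j (g := C * dens k n ^ (j + 1)) ?_).trans ?_
  · rw [div_lt_div_iff₀ hn0 (by positivity)] at hs
    rw [hkd, pow_succ]
    nlinarith
  · refine add_le_add (add_le_add ?_ le_rfl) (add_le_add ?_ (Real.exp_le_exp.mpr ?_))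
    · refine trajProb_mono (by omega) fun x G => ?_
      contrapose!
      exact fun hG => hG.2
    · rw [one_div, ← Real.exp_neg]
      apply Real.exp_le_exp.mpr
      have hn2 : 0 < (n : ℝ) - 2 := by linarith
      have : C * dens k n ^ (j + 1) / (n - 2) ≤ (1 - ε / 4) * Real.log n := by
        calc C * dens k n ^ (j + 1) / (n - 2)
            ≤ C * ((1 - ε) * n * Real.log n) / (n - 2) := by gcongr
          _ = (C * (1 - ε)) * (n / (n - 2)) * Real.log n := by ring
          _ ≤ (1 - ε / 2) * (n / (n - 2)) * Real.log n := by gcongr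
          _ ≤ (1 - ε / 4) * Real.log n := by gcongr
      linarith
    · rw [hkd]
      apply le_of_eq
      field_simp

end CriticalDensity

end Asymptotics

end Broadcasting

/-- **Theorem 1.1(g).**  Fix an integer `i ≥ 2` and suppose `k = k(n) = n^{1+1/i+o(1)}`, i.e.
`ln k(n)/ln n → 1 + 1/i`.  Then:
(1) if `(k/n)^i < (1−ε)·n ln n` (for some fixed `ε > 0` and all large `n`), then a.a.s.
    `ξ(K_n, k) = i + 1`;
(2) if `(k/n)^i > (1+ε)·n ln n` (for some fixed `ε > 0` and all large `n`), then a.a.s.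
    `ξ(K_n, k) = i`;
(3) in all cases, a.a.s. `ξ(K_n, k) ∈ {i, i+1}`. -/
theorem broadcasting_time_critical_k
    (i : ℕ) (hi : 2 ≤ i) (k : ℕ → ℕ)
    (hk : Tendsto (fun n => Real.log (k n) / Real.log n) atTop (nhds (1 + 1 / (i : ℝ)))) :
    ((∃ ε > (0:ℝ), ∀ᶠ n : ℕ in atTop, ((k n : ℝ) / n) ^ i < (1 - ε) * n * Real.log n) →
      Tendsto (fun n => probXiMem n (k n) {i + 1}) atTop (nhds 1)) ∧
    ((∃ ε > (0:ℝ), ∀ᶠ n : ℕ in atTop, ((k n : ℝ) / n) ^ i > (1 + ε) * n * Real.log n) →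
      Tendsto (fun n => probXiMem n (k n) {i}) atTop (nhds 1)) ∧
    Tendsto (fun n => probXiMem n (k n) ({i, i + 1} : Set ℕ)) atTop (nhds 1) := by
  obtain ⟨j, rfl⟩ : ∃ j, i = j + 1 := ⟨i - 1, by omega⟩
  have hj : 1 ≤ j := by omega
  have hd := Broadcasting.criticalDensity hk
  have h0 := hd.tendsto_probXiLe_before
  have h2 := hd.tendsto_probXiLe_after hj
  simp only [Broadcasting.probXiMem_singleton_succ, Broadcasting.probXiMem_pair_succ]
  refine ⟨?_, ?_, by simpa using h2.sub h0⟩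
  · rintro ⟨ε, hε, h⟩
    simpa using h2.sub (hd.tendsto_probXiLe_of_lt hj hε h)
  · rintro ⟨ε, hε, h⟩
    simpa using (hd.tendsto_probXiLe_of_gt hj hε h).sub h0
end

section
/- Key combinatorial estimate in the proof of Lemma 4.2. Let ω₀ = ω₀(n) be any function tending to infinity as n → ∞. Then for all sufficiently large n the following holds: for all integers s and r with ln n ≤ s ≤ n/ω₀ and r = ⌈3s/ln ω₀⌉ (with r < s), one has C(n, s−r) · ((s−r)/(n−1))^s ≤ n^{−2}, where C(n, m) denotes the binomial coefficient 'n choose m'. -/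
open Filter

theorem choose_mul_pow_self_le (n m : ℕ) :
    (n.choose m : ℝ) * (m : ℝ) ^ m ≤ (n : ℝ) ^ m * Real.exp m := by
  have hm : (0 : ℝ) < m.factorial := by exact_mod_cast m.factorial_pos
  have hexp : (m : ℝ) ^ m / m.factorial ≤ Real.exp m :=
    Real.pow_div_factorial_le_exp (m : ℝ) (Nat.cast_nonneg m) m
  calc (n.choose m : ℝ) * (m : ℝ) ^ m ≤ (n : ℝ) ^ m / m.factorial * (m : ℝ) ^ m := by
        gcongr
        exact Nat.choose_le_pow_div m n
    _ = (n : ℝ) ^ m * ((m : ℝ) ^ m / m.factorial) := by ring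
    _ ≤ (n : ℝ) ^ m * Real.exp m := by gcongr

theorem div_sub_one_pow_le_exp {x : ℝ} (hx : 1 < x) {s : ℕ} (hs : (s : ℝ) ≤ x - 1) :
    (x / (x - 1)) ^ s ≤ Real.exp 1 := by
  have hx' : 0 < x - 1 := sub_pos.mpr hx
  have hbase : x / (x - 1) ≤ Real.exp (1 / (x - 1)) := by
    have h := Real.add_one_le_exp (1 / (x - 1))
    have h' : x / (x - 1) = 1 / (x - 1) + 1 := by field_simp; ring
    exact h'.trans_le h
  calc (x / (x - 1)) ^ s ≤ Real.exp (1 / (x - 1)) ^ s := by gcongr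
    _ = Real.exp (s / (x - 1)) := by rw [← Real.exp_nat_mul]; ring_nf
    _ ≤ Real.exp 1 := by
        gcongr
        exact (div_le_one hx').mpr hs

theorem inv_pow_le_exp_neg {w t : ℝ} (hw : 1 < w) {r : ℕ} (hr : t / Real.log w ≤ r) :
    w⁻¹ ^ r ≤ Real.exp (-t) := by
  have hw0 : 0 < w := one_pos.trans hw
  have ht : t ≤ r * Real.log w := (div_le_iff₀ (Real.log_pos hw)).mp hr
  calc w⁻¹ ^ r = Real.exp (-(r * Real.log w)) := by
        rw [Real.exp_neg, Real.exp_nat_mul, Real.exp_log hw0, inv_pow]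
    _ ≤ Real.exp (-t) := by gcongr

/-- **Key combinatorial estimate in the proof of Lemma 4.2.**  For any `ω₀ = ω₀(n) → ∞` and all
sufficiently large `n`: for all integers `s`, `r` with `ln n ≤ s ≤ n/ω₀` and
`r = ⌈3s/ln ω₀⌉ < s`, one has `C(n, s−r)·((s−r)/(n−1))^s ≤ n⁻²`. -/
theorem binomial_occupancy_estimate
    (ω₀ : ℕ → ℝ) (hω₀ : Tendsto ω₀ atTop atTop) :
    ∀ᶠ n : ℕ in atTop, ∀ s r : ℕ,
      Real.log n ≤ (s : ℝ) → (s : ℝ) ≤ (n : ℝ) / ω₀ n →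
      r = ⌈3 * (s : ℝ) / Real.log (ω₀ n)⌉₊ → r < s →
      (n.choose (s - r) : ℝ) * (((s : ℝ) - (r : ℝ)) / ((n : ℝ) - 1)) ^ s
        ≤ ((n : ℝ) ^ 2)⁻¹ := by
  filter_upwards [hω₀.eventually_ge_atTop 2, eventually_ge_atTop 2] with n hω hn s r hlog hsn hr hrs
  have hn2 : (2 : ℝ) ≤ n := by exact_mod_cast hn
  have hn0 : (0 : ℝ) < n := by linarith
  have hn1 : (0 : ℝ) < (n : ℝ) - 1 := by linarith
  have hω0 : 0 < ω₀ n := by linarith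
  have hω1 : 1 < ω₀ n := by linarith
  have hs0 : (0 : ℝ) < s := by exact_mod_cast hrs.pos
  have hr1 : 1 ≤ r := by
    rw [hr, Nat.one_le_ceil_iff]
    have := Real.log_pos hω1
    positivity
  have hrceil : 3 * (s : ℝ) / Real.log (ω₀ n) ≤ r := hr ▸ Nat.le_ceil _
  have hs1 : (s : ℝ) ≤ n - 1 := by
    have : (n : ℝ) / ω₀ n ≤ n / 2 := by gcongr
    linarith
  obtain ⟨k, rfl⟩ := Nat.exists_eq_add_of_le' hrs.le
  have hcast : ((k + r : ℕ) : ℝ) - r = k := by push_cast; ring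
  have hkω : (k : ℝ) / n ≤ (ω₀ n)⁻¹ := by
    have hle : (k : ℝ) ≤ n / ω₀ n := by
      refine le_trans ?_ hsn
      exact_mod_cast Nat.le_add_right k r
    rw [div_le_iff₀ hn0]
    exact hle.trans_eq (by ring)
  rw [Nat.add_sub_cancel, hcast]
  calc (n.choose k : ℝ) * ((k : ℝ) / (n - 1)) ^ (k + r)
      = (n.choose k : ℝ) * (k : ℝ) ^ k * ((k : ℝ) ^ r / ((n : ℝ) - 1) ^ (k + r)) := by
        rw [div_pow, pow_add (k : ℝ)]; ring
    _ ≤ (n : ℝ) ^ k * Real.exp k * ((k : ℝ) ^ r / ((n : ℝ) - 1) ^ (k + r)) := by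
        refine mul_le_mul_of_nonneg_right (choose_mul_pow_self_le n k) ?_
        positivity
    _ = Real.exp k * ((k : ℝ) / n) ^ r * ((n : ℝ) / (n - 1)) ^ (k + r) := by
        rw [div_pow, div_pow, pow_add (n : ℝ)]
        field_simp
    _ ≤ Real.exp k * Real.exp (-(3 * (k + r : ℕ))) * Real.exp 1 := by
        gcongr
        · exact (pow_le_pow_left₀ (by positivity) hkω r).trans (inv_pow_le_exp_neg hω1 hrceil)
        · exact div_sub_one_pow_le_exp (by linarith) hs1
    _ ≤ Real.exp (-(2 * Real.log n)) := by
        rw [← Real.exp_add, ← Real.exp_add, Real.exp_le_exp]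
        have : (1 : ℝ) ≤ r := by exact_mod_cast hr1
        push_cast at hlog ⊢
        linarith
    _ = ((n : ℝ) ^ 2)⁻¹ := by
        rw [Real.exp_neg, two_mul, Real.exp_add, Real.exp_log hn0, sq]
end
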